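/- Let θ_0,…,θ_d, x_0,…,x_d, y_1,…,y_d, z_1,…,z_d be scalars in F with y_i·z_i ≠ 0 for 1 ≤ i ≤ d. Let A ∈ Mat_{d+1}(F) be the lower bidiagonal matrix with diagonal entries θ_0,…,θ_d and all subdiagonal entries 1, and A* ∈ Mat_{d+1}(F) the tridiagonal matrix with diagonal entries x_0,…,x_d, superdiagonal entries y_1,…,y_d, and subdiagonal entries z_1,…,z_d. Assume (A, A*) is a Leonard pair in Mat_{d+1}(F), and let q ∈ F be nonzero and not a root of unity with θ_{i−2} − θ_{i+1} = (q² + q^{−2} + 1)(θ_{i−1} − θ_i) for 2 ≤ i ≤ d−1. Then there exists p ∈ {q, q^{−1}} and scalars α, α*, a, a′, b, b′, c ∈ F with c ≠ 0 such that: θ_i = α + a·p^{2i−d} + a′·p^{d−2i} and x_i = α* + (b+b′)p^{d−2i} + a′c·p^{d−2i}(p^{d+1} + p^{−d−1} − p^{d−2i−1} − p^{d−2i+1}) for 0 ≤ i ≤ d; y_i = (p^i − p^{−i})(p^{d−i+1} − p^{i−d−1})(b − a′c·p^{d−2i+1})(b′ − a′c·p^{d−2i+1})c^{−1} and z_i =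 −c·p^{d−2i+1} for 1 ≤ i ≤ d; and moreover (C1) a ≠ a′p^{2d−2j} for 1 ≤ j ≤ 2d−1, (C2) b ≠ b′p^{2d−2j} for 1 ≤ j ≤ 2d−1, and (C3) neither b·c^{−1} nor b′·c^{−1} belongs to {a·p^{d−2j+1} : 1 ≤ j ≤ d} ∪ {a′·p^{d−2j+1} : 1 ≤ j ≤ d}. -/

import Mathlib

def IsTridiagonal {F : Type*} [Field F] {n : ℕ} (M : Matrix (Fin n) (Fin n) F) : Prop :=
  ∀ i j : Fin n,
    ¬((i : ℕ) = (j : ℕ) ∨ (i : ℕ) = (j : ℕ) + 1 ∨ (j : ℕ) = (i : ℕ) + 1) → M i j = 0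

def IsIrredTridiagonal {F : Type*} [Field F] {n : ℕ} (M : Matrix (Fin n) (Fin n) F) : Prop :=
  IsTridiagonal M ∧
    ∀ i j : Fin n, ((i : ℕ) = (j : ℕ) + 1 ∨ (j : ℕ) = (i : ℕ) + 1) → M i j ≠ 0

def IsLowerBidiagonal {F : Type*} [Field F] {n : ℕ} (M : Matrix (Fin n) (Fin n) F) : Prop :=
  ∀ i j : Fin n, ¬((i : ℕ) = (j : ℕ) ∨ (i : ℕ) = (j : ℕ) + 1) → M i j = 0

/-- A Leonard pair in `Mat_{n}(F)`: each matrix is irreducible tridiagonal in some basis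
diagonalizing the other one. -/
def IsLeonardPair {F : Type*} [Field F] {n : ℕ} (A As : Matrix (Fin n) (Fin n) F) : Prop :=
  (∃ P : Matrix (Fin n) (Fin n) F, IsUnit P ∧
    IsIrredTridiagonal (P⁻¹ * A * P) ∧ (P⁻¹ * As * P).IsDiag) ∧
  (∃ Q : Matrix (Fin n) (Fin n) F, IsUnit Q ∧
    IsIrredTridiagonal (Q⁻¹ * As * Q) ∧ (Q⁻¹ * A * Q).IsDiag)

section leonardPair

open Matrix

theorem IsIrredTridiagonal.eq_zero_of_commute {F : Type*} [Field F] {d : ℕ}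
    {H N : Matrix (Fin (d + 1)) (Fin (d + 1)) F} (hH : IsIrredTridiagonal H)
    (hc : H * N = N * H) (h0 : ∀ i, N i 0 = 0) : N = 0 := by
  have key : ∀ j : ℕ, ∀ hj : j < d + 1, ∀ i, N i ⟨j, hj⟩ = 0 := by
    intro j
    induction j using Nat.strong_induction_on with
    | _ j ih =>
      intro hj i
      rcases j with _ | j
      · exact h0 i
      · have e := congrFun (congrFun hc i) ⟨j, by omega⟩
        rw [mul_apply, mul_apply, Finset.sum_eq_zero, Finset.sum_eq_single ⟨j + 1, hj⟩] at e
        · exact (mul_eq_zero.1 e.symm).resolve_right (hH.2 _ _ (Or.inl rfl))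
        · intro k _ hk
          have hk' : (k : ℕ) ≠ j + 1 := fun h => hk (Fin.ext h)
          by_cases hkj : (k : ℕ) ≤ j
          · rw [ih k (by omega) k.2 i, zero_mul]
          · rw [hH.1 k ⟨j, by omega⟩ (by simp only; omega), mul_zero]
        · simp
        · intro k _
          rw [ih j (by omega) (by omega) k, mul_zero]
  ext i j
  exact key j j.2 i

theorem IsIrredTridiagonal.exists_quadratic {F : Type*} [Field F] {d : ℕ} (hd : 2 ≤ d)
    {H M : Matrix (Fin (d + 1)) (Fin (d + 1)) F} (hH : IsIrredTridiagonal H)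
    (hc : H * M = M * H) (h0 : ∀ i : Fin (d + 1), 2 < (i : ℕ) → M i 0 = 0) :
    ∃ c₂ c₁ c₀ : F, M = c₂ • (H * H) + c₁ • H + c₀ • 1 := by
  have hz : ((0 : Fin (d + 1)) : ℕ) = 0 := rfl
  have h20 : (H * H) ⟨2, by omega⟩ 0 ≠ 0 := by
    rw [mul_apply, Finset.sum_eq_single ⟨1, by omega⟩]
    · exact mul_ne_zero (hH.2 _ _ (Or.inl rfl)) (hH.2 _ _ (Or.inl rfl))
    · intro k _ hk
      have hk' : (k : ℕ) ≠ 1 := fun h => hk (Fin.ext h)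
      by_cases hk0 : (k : ℕ) = 0
      · rw [hH.1 ⟨2, by omega⟩ k (by simp only; omega), zero_mul]
      · rw [hH.1 k 0 (by omega), mul_zero]
    · simp
  have hi0 : ∀ i : Fin (d + 1), 2 < (i : ℕ) → (H * H) i 0 = 0 := by
    intro i hi
    rw [mul_apply]
    refine Finset.sum_eq_zero fun k _ => ?_
    by_cases hk : (k : ℕ) ≤ 1
    · rw [hH.1 i k (by omega), zero_mul]
    · rw [hH.1 k 0 (by omega), mul_zero]
  have h10 : H ⟨1, by omega⟩ 0 ≠ 0 := hH.2 _ _ (Or.inl rfl)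
  obtain ⟨c₂, hc₂⟩ : ∃ c, c = M ⟨2, by omega⟩ 0 / (H * H) ⟨2, by omega⟩ 0 := ⟨_, rfl⟩
  obtain ⟨c₁, hc₁⟩ : ∃ c, c = (M ⟨1, by omega⟩ 0 - c₂ * (H * H) ⟨1, by omega⟩ 0) /
    H ⟨1, by omega⟩ 0 := ⟨_, rfl⟩
  obtain ⟨c₀, hc₀⟩ : ∃ c, c = M 0 0 - c₂ * (H * H) 0 0 - c₁ * H 0 0 := ⟨_, rfl⟩
  refine ⟨c₂, c₁, c₀, sub_eq_zero.1 (hH.eq_zero_of_commute ?_ ?_)⟩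
  · simp only [mul_sub, sub_mul, mul_add, add_mul, hc, mul_smul_comm, smul_mul_assoc,
      Matrix.mul_assoc, mul_one, one_mul]
  · intro i
    simp only [Matrix.sub_apply, Matrix.add_apply, Matrix.smul_apply, smul_eq_mul]
    by_cases h : (i : ℕ) = 0
    · obtain rfl : i = 0 := Fin.ext h
      rw [one_apply_eq, hc₀]
      ring
    rw [one_apply_ne (fun e => h (congrArg _ e))]
    by_cases h1 : (i : ℕ) = 1
    · rw [show i = ⟨1, by omega⟩ from Fin.ext h1, hc₁]
      field_simp
      ring
    by_cases h2 : (i : ℕ) = 2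
    · rw [show i = ⟨2, by omega⟩ from Fin.ext h2, hH.1 ⟨2, by omega⟩ 0 (by simp only; omega), hc₂]
      field_simp
      ring
    rw [h0 i (by omega), hi0 i (by omega), hH.1 i 0 (by omega)]
    ring

/-- The tridiagonal-relation expression `a²b - βaba + ba² - γ(ab + ba) - ρb`. -/
def tridiagonalExpr {F R : Type*} [Field F] [Ring R] [Algebra F R] (β γ ρ : F) (a b : R) : R :=
  a * a * b - β • (a * b * a) + b * a * a - γ • (a * b + b * a) - ρ • b

theorem map_tridiagonalExpr {F R S : Type*} [Field F] [Ring R] [Algebra F R] [Ring S]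
    [Algebra F S] (f : R →ₐ[F] S) (β γ ρ : F) (a b : R) :
    f (tridiagonalExpr β γ ρ a b) = tridiagonalExpr β γ ρ (f a) (f b) := by
  simp [tridiagonalExpr]

theorem tridiagonalExpr_diagonal_apply {F : Type*} [Field F] {n : ℕ} (β γ ρ : F) (t : Fin n → F)
    (T : Matrix (Fin n) (Fin n) F) (i j : Fin n) :
    tridiagonalExpr β γ ρ (diagonal t) T i j =
      (t i ^ 2 - β * t i * t j + t j ^ 2 - γ * (t i + t j) - ρ) * T i j := by
  simp only [tridiagonalExpr, Matrix.sub_apply, Matrix.add_apply, Matrix.smul_apply, smul_eq_mul,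
    Matrix.mul_assoc, mul_diagonal, diagonal_mul]
  simp only [← Matrix.mul_assoc, mul_diagonal]
  ring

theorem IsTridiagonal.commute_tridiagonalExpr {F : Type*} [Field F] {n : ℕ} {β γ ρ : F}
    {t : ℕ → F} {T : Matrix (Fin n) (Fin n) F} (hT : IsTridiagonal T)
    (ht : ∀ i, i + 1 < n →
      t i ^ 2 - β * t i * t (i + 1) + t (i + 1) ^ 2 - γ * (t i + t (i + 1)) = ρ) :
    diagonal (fun i : Fin n => t i) * tridiagonalExpr β γ ρ (diagonal fun i : Fin n => t i) T =
      tridiagonalExpr β γ ρ (diagonal fun i : Fin n => t i) T *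
        diagonal (fun i : Fin n => t i) := by
  ext i j
  rw [diagonal_mul, mul_diagonal, tridiagonalExpr_diagonal_apply]
  by_cases h1 : (i : ℕ) = j
  · rw [h1]; ring
  by_cases h2 : (i : ℕ) = j + 1
  · have := ht j (by omega)
    rw [h2]
    linear_combination (t (j + 1) - t j) * T i j * this
  by_cases h3 : (j : ℕ) = i + 1
  · have := ht i (by omega)
    rw [h3]
    linear_combination (t i - t (i + 1)) * T i j * this
  rw [hT i j (by omega)]
  ring

theorem invariant_of_recurrence {F : Type*} [Field F] {β γ : F} {d : ℕ} {t : ℕ → F}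
    (ht : ∀ i, i + 2 ≤ d → t i - β * t (i + 1) + t (i + 2) = γ) :
    ∀ i, i + 1 ≤ d →
      t i ^ 2 - β * t i * t (i + 1) + t (i + 1) ^ 2 - γ * (t i + t (i + 1)) =
        t 0 ^ 2 - β * t 0 * t 1 + t 1 ^ 2 - γ * (t 0 + t 1) := by
  intro i
  induction i with
  | zero => intro _; rfl
  | succ i ih =>
    intro hi
    rw [← ih (by omega)]
    linear_combination (t (i + 2) - t i) * ht i (by omega)

/-- Conjugation by a unit, as an algebra homomorphism. -/
def conjHom (F : Type*) {R : Type*} [Field F] [Ring R] [Algebra F R] (u : Rˣ) : R →ₐ[F] R where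
  toFun a := ↑u⁻¹ * a * u
  map_one' := by simp
  map_mul' a b := by simp [mul_assoc]
  map_zero' := by simp
  map_add' a b := by simp [mul_add, add_mul]
  commutes' r := by rw [← Algebra.commutes r (↑u⁻¹ : R), mul_assoc, Units.inv_mul, mul_one]

theorem conjHom_injective {F R : Type*} [Field F] [Ring R] [Algebra F R] (u : Rˣ) :
    Function.Injective (conjHom F u) := by
  intro a b h
  simpa [conjHom] using h

/-- `U` and `V` are inverse to each other and conjugate `A` to the diagonal matrix of `t`. -/
structure DiagonalizedBy {F : Type*} [Field F] {n : ℕ} (A U V : Matrix (Fin n) (Fin n) F)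
    (t : Fin n → F) : Prop where
  inv_mul : V * U = 1
  mul_right : A * U = U * diagonal t

theorem DiagonalizedBy.mul_left {F : Type*} [Field F] {n : ℕ} {A U V : Matrix (Fin n) (Fin n) F}
    {t : Fin n → F} (hu : DiagonalizedBy A U V t) : V * A = diagonal t * V := by
  have h : U * V = 1 := mul_eq_one_comm.1 hu.inv_mul
  calc V * A = V * (A * U) * V := by rw [Matrix.mul_assoc, Matrix.mul_assoc, h, mul_one]
    _ = diagonal t * V := by
      rw [hu.mul_right, ← Matrix.mul_assoc, hu.inv_mul, one_mul]

theorem IsIrredTridiagonal.eq_zero_of_mulVec {F : Type*} [Field F] {d : ℕ}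
    {H : Matrix (Fin (d + 1)) (Fin (d + 1)) F} (hH : IsIrredTridiagonal H)
    {v : Fin (d + 1) → F} {μ : F} (hv : ∀ i, ∑ l, H i l * v l = μ * v i) (h0 : v 0 = 0) :
    v = 0 := by
  have key : ∀ k : ℕ, ∀ hk : k < d + 1, v ⟨k, hk⟩ = 0 := by
    intro k
    induction k using Nat.strong_induction_on with
    | _ k ih =>
      intro hk
      rcases k with _ | k
      · exact h0
      · have e := hv ⟨k, by omega⟩
        rw [ih k (by omega) (by omega), mul_zero, Finset.sum_eq_single ⟨k + 1, hk⟩] at e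
        · exact (mul_eq_zero.1 e).resolve_left (hH.2 _ _ (Or.inr rfl))
        · intro l _ hl
          have hl' : (l : ℕ) ≠ k + 1 := fun h => hl (Fin.ext h)
          by_cases hlk : (l : ℕ) ≤ k
          · rw [ih l (by omega) l.2, mul_zero]
          · rw [hH.1 ⟨k, by omega⟩ l (by simp only; omega), zero_mul]
        · simp
  exact funext fun k => key k k.2

theorem IsIrredTridiagonal.injective_of_diagonalizedBy {F : Type*} [Field F] {d : ℕ}
    {H U V : Matrix (Fin (d + 1)) (Fin (d + 1)) F} (hH : IsIrredTridiagonal H)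
    {t : Fin (d + 1) → F} (hu : DiagonalizedBy H U V t) : Function.Injective t := by
  have hcol : ∀ i k, ∑ l, H k l * U l i = t i * U k i := fun i k => by
    rw [← mul_apply, hu.mul_right, mul_diagonal, mul_comm]
  have hne : ∀ i, U 0 i ≠ 0 := fun i h0 => by
    have hz := hH.eq_zero_of_mulVec (hcol i) h0
    have := congrFun (congrFun hu.inv_mul i) i
    rw [mul_apply, one_apply_eq] at this
    have hz' : ∀ l, U l i = 0 := congrFun hz
    simp [hz'] at this
  intro i j hij
  by_contra hij'
  have hz := hH.eq_zero_of_mulVec (v := fun l => U 0 j * U l i - U 0 i * U l j) (μ := t i)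
    (fun k => by
      calc _ = U 0 j * (∑ l, H k l * U l i) - U 0 i * ∑ l, H k l * U l j := by
            rw [Finset.mul_sum, Finset.mul_sum, ← Finset.sum_sub_distrib]
            exact Finset.sum_congr rfl fun _ _ => by ring
        _ = _ := by
            rw [hcol, hcol, hij]
            ring) (by ring)
  have hsum : ∑ l, V i l * (U 0 j * U l i - U 0 i * U l j) = 0 :=
    Finset.sum_eq_zero fun l _ => by rw [congrFun hz l, Pi.zero_apply, mul_zero]
  have hexp : ∑ l, V i l * (U 0 j * U l i - U 0 i * U l j) =
      U 0 j * (V * U) i i - U 0 i * (V * U) i j := by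
    rw [mul_apply, mul_apply, Finset.mul_sum, Finset.mul_sum, ← Finset.sum_sub_distrib]
    exact Finset.sum_congr rfl fun _ _ => by ring
  rw [hexp, hu.inv_mul, one_apply_eq, one_apply_ne hij', mul_one, mul_zero, sub_zero] at hsum
  exact hne j hsum

/-- The entry of `M` in row `m` and column `j`, understood as `0` when `m` is out of range. -/
def rowExt {F : Type*} [Field F] {n : ℕ} (M : Matrix (Fin n) (Fin n) F) (m : ℤ) (j : Fin n) : F :=
  ∑ k : Fin n, if ((k : ℕ) : ℤ) = m then M k j else 0

section rowExt

variable {F : Type*} [Field F] {n : ℕ} (M N : Matrix (Fin n) (Fin n) F) (m : ℤ) (j : Fin n)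

theorem rowExt_add : rowExt (M + N) m j = rowExt M m j + rowExt N m j := by
  rw [rowExt, rowExt, rowExt, ← Finset.sum_add_distrib]
  exact Finset.sum_congr rfl fun k _ => by split_ifs <;> simp

theorem rowExt_sub : rowExt (M - N) m j = rowExt M m j - rowExt N m j := by
  rw [rowExt, rowExt, rowExt, ← Finset.sum_sub_distrib]
  exact Finset.sum_congr rfl fun k _ => by split_ifs <;> simp

theorem rowExt_smul (c : F) : rowExt (c • M) m j = c * rowExt M m j := by
  rw [rowExt, rowExt, Finset.mul_sum]
  exact Finset.sum_congr rfl fun k _ => by split_ifs <;> simp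

theorem rowExt_coe (k : Fin n) : rowExt M ((k : ℕ) : ℤ) j = M k j := by
  rw [rowExt, Finset.sum_eq_single k]
  · simp
  · intro l _ hl
    rw [if_neg]
    exact fun h => hl (Fin.ext (by exact_mod_cast h))
  · simp

theorem rowExt_of_out (hm : m < 0 ∨ (n : ℤ) ≤ m) : rowExt M m j = 0 :=
  Finset.sum_eq_zero fun k _ => if_neg (by have := k.2; omega)

theorem rowExt_one :
    rowExt (1 : Matrix (Fin n) (Fin n) F) m j = if m = ((j : ℕ) : ℤ) then 1 else 0 := by
  rw [rowExt, Finset.sum_eq_single j]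
  · rw [one_apply_eq]
    exact if_congr eq_comm rfl rfl
  · intro l _ hl
    rw [one_apply_ne hl, ite_self]
  · simp

/-- `T` is tridiagonal with diagonal `x`, subdiagonal `z` and superdiagonal `y`, the off-diagonal
sequences being zero out of range. -/
structure HasBands (T : Matrix (Fin n) (Fin n) F) (z x y : ℤ → F) : Prop where
  apply : ∀ i j : Fin n, T i j = (if ((j : ℕ) : ℤ) = (i : ℕ) - 1 then z (i : ℕ) else 0) +
    (if ((j : ℕ) : ℤ) = (i : ℕ) then x (i : ℕ) else 0) +
    (if ((j : ℕ) : ℤ) = (i : ℕ) + 1 then y ((i : ℕ) + 1) else 0)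
  sub_eq_zero : ∀ i : ℤ, i ≤ 0 ∨ (n : ℤ) ≤ i → z i = 0
  super_eq_zero : ∀ i : ℤ, i ≤ 0 ∨ (n : ℤ) ≤ i → y i = 0

variable {M N m j}

theorem HasBands.rowExt_mul {T : Matrix (Fin n) (Fin n) F} {z x y : ℤ → F} (hT : HasBands T z x y)
    (M : Matrix (Fin n) (Fin n) F) (m : ℤ) (j : Fin n) :
    rowExt (T * M) m j =
      z m * rowExt M (m - 1) j + x m * rowExt M m j + y (m + 1) * rowExt M (m + 1) j := by
  by_cases hm : m < 0 ∨ (n : ℤ) ≤ m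
  · rw [rowExt_of_out _ _ _ hm, rowExt_of_out M _ _ hm, hT.sub_eq_zero m (by omega),
      hT.super_eq_zero (m + 1) (by omega)]
    ring
  · obtain ⟨k, rfl⟩ : ∃ k : Fin n, m = ((k : ℕ) : ℤ) :=
      ⟨⟨m.toNat, by omega⟩, by simp only; omega⟩
    rw [rowExt_coe, mul_apply]
    simp only [hT.apply, add_mul, Finset.sum_add_distrib, rowExt, Finset.mul_sum]
    congr 1
    · congr 1
      all_goals exact Finset.sum_congr rfl fun l _ => by split_ifs <;> simp
    · exact Finset.sum_congr rfl fun l _ => by split_ifs <;> simp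

theorem HasBands.transpose {T : Matrix (Fin n) (Fin n) F} {z x y : ℤ → F} (hT : HasBands T z x y) :
    HasBands Tᵀ y x z where
  apply i j := by
    rw [transpose_apply, hT.apply]
    generalize ((i : ℕ) : ℤ) = a, ((j : ℕ) : ℤ) = b
    split_ifs
    all_goals first | omega | simp
    all_goals exact congrArg _ (by omega)
  sub_eq_zero := hT.super_eq_zero
  super_eq_zero := hT.sub_eq_zero

end rowExt

section relations

variable {F : Type*} [Field F] {n : ℕ} {A As : Matrix (Fin n) (Fin n) F} {s θ z x y : ℤ → F}
  {β γ ρ c₂ c₁ c₀ : F}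

theorem HasBands.rowExt_eq {T : Matrix (Fin n) (Fin n) F} (hT : HasBands T z x y)
    (m : ℤ) (j : Fin n) :
    rowExt T m j = z m * (if m - 1 = ((j : ℕ) : ℤ) then 1 else 0) +
      x m * (if m = ((j : ℕ) : ℤ) then 1 else 0) +
      y (m + 1) * (if m + 1 = ((j : ℕ) : ℤ) then 1 else 0) := by
  rw [← rowExt_one, ← rowExt_one, ← rowExt_one, ← hT.rowExt_mul, mul_one]

theorem rowExt_relation (h : tridiagonalExpr β γ ρ A As = c₂ • (A * A) + c₁ • A + c₀ • 1)
    (m : ℤ) (j : Fin n) :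
    rowExt (A * (A * As)) m j - β * rowExt (A * (As * A)) m j + rowExt (As * (A * A)) m j
      - γ * (rowExt (A * As) m j + rowExt (As * A) m j) - ρ * rowExt As m j =
      c₂ * rowExt (A * A) m j + c₁ * rowExt A m j + c₀ * rowExt 1 m j := by
  simpa only [tridiagonalExpr, rowExt_sub, rowExt_add, rowExt_smul, Matrix.mul_assoc] using
    congrArg (fun M => rowExt M m j) h

theorem mul_super (hAs : HasBands As z x y) (hs : ∀ i : ℤ, 1 ≤ i → i < n → s i = 1) (i : ℤ) :
    s i * y i = y i := by
  by_cases hi : i ≤ 0 ∨ (n : ℤ) ≤ i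
  · rw [hAs.super_eq_zero i hi, mul_zero]
  · rw [hs i (by omega) (by omega), one_mul]

theorem sub_recurrence (hA : HasBands A s θ 0) (hAs : HasBands As z x y)
    (hs : ∀ i : ℤ, 1 ≤ i → i < n → s i = 1)
    (h : tridiagonalExpr β γ ρ A As = c₂ • (A * A) + c₁ • A + c₀ • 1)
    {k : ℤ} (hk : 0 ≤ k) (hkn : k + 3 < n) :
    z (k + 1) - β * z (k + 2) + z (k + 3) = 0 := by
  have e := rowExt_relation h (k + 3) ⟨(k).toNat, by omega⟩
  simp only [hA.rowExt_mul, hAs.rowExt_mul, hA.rowExt_eq, hAs.rowExt_eq, rowExt_one,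
    Int.toNat_of_nonneg (show 0 ≤ k by omega), Pi.zero_apply, zero_mul, add_zero] at e
  simp (disch := omega) only [if_neg, if_pos, mul_zero, add_zero, mul_one, sub_zero,
    hs] at e
  ring_nf at e ⊢
  linear_combination e

theorem inv_sub_recurrence (hA : HasBands A s θ 0) (hAs : HasBands As z x y)
    (hs : ∀ i : ℤ, 1 ≤ i → i < n → s i = 1)
    (h : tridiagonalExpr β γ ρ As A = c₂ • (As * As) + c₁ • As + c₀ • 1)
    {k : ℤ} (hk : 0 ≤ k) (hkn : k + 3 < n) :
    z (k + 3) * z (k + 2) - β * (z (k + 3) * z (k + 1)) + z (k + 2) * z (k + 1) = 0 := by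
  have e := rowExt_relation h (k + 3) ⟨(k).toNat, by omega⟩
  simp only [hA.rowExt_mul, hAs.rowExt_mul, hA.rowExt_eq, hAs.rowExt_eq, rowExt_one,
    Int.toNat_of_nonneg (show 0 ≤ k by omega), Pi.zero_apply, zero_mul, add_zero] at e
  simp (disch := omega) only [if_neg, if_pos, mul_zero, add_zero, mul_one, sub_zero,
    hs] at e
  ring_nf at e ⊢
  linear_combination e

theorem diag_recurrence (hA : HasBands A s θ 0) (hAs : HasBands As z x y)
    (hs : ∀ i : ℤ, 1 ≤ i → i < n → s i = 1)
    (h : tridiagonalExpr β γ ρ A As = c₂ • (A * A) + c₁ • A + c₀ • 1)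
    {k : ℤ} (hk : 0 ≤ k) (hkn : k + 2 < n) :
    (θ (k + 2) + θ (k + 1)) * z (k + 1) + x k -
      β * (θ (k + 2) * z (k + 2) + θ k * z (k + 1) + x (k + 1)) + x (k + 2) +
      z (k + 2) * (θ (k + 1) + θ k) - γ * (z (k + 1) + z (k + 2)) = c₂ := by
  have e := rowExt_relation h (k + 2) ⟨(k).toNat, by omega⟩
  simp only [hA.rowExt_mul, hAs.rowExt_mul, hA.rowExt_eq, hAs.rowExt_eq, rowExt_one,
    Int.toNat_of_nonneg (show 0 ≤ k by omega), Pi.zero_apply, zero_mul, add_zero] at e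
  simp (disch := omega) only [if_neg, if_pos, mul_zero, add_zero, mul_one, sub_zero,
    hs] at e
  ring_nf at e ⊢
  linear_combination e

theorem diag_sub_recurrence (hA : HasBands A s θ 0) (hAs : HasBands As z x y)
    (hs : ∀ i : ℤ, 1 ≤ i → i < n → s i = 1)
    (h : tridiagonalExpr β γ ρ As A = c₂ • (As * As) + c₁ • As + c₀ • 1)
    {k : ℤ} (hk : 0 ≤ k) (hkn : k + 2 < n) :
    z (k + 2) * (x (k + 2) + x (k + 1) - β * x k - γ) +
      z (k + 1) * (x (k + 1) + x k - β * x (k + 2) - γ) +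
      (θ k + θ (k + 2) - β * θ (k + 1) - c₂) * (z (k + 2) * z (k + 1)) = 0 := by
  have e := rowExt_relation h (k + 2) ⟨(k).toNat, by omega⟩
  simp only [hA.rowExt_mul, hAs.rowExt_mul, hA.rowExt_eq, hAs.rowExt_eq, rowExt_one,
    Int.toNat_of_nonneg (show 0 ≤ k by omega), Pi.zero_apply, zero_mul, add_zero] at e
  simp (disch := omega) only [if_neg, if_pos, mul_zero, add_zero, mul_one, sub_zero,
    hs] at e
  ring_nf at e ⊢
  linear_combination e

theorem super_recurrence (hA : HasBands A s θ 0) (hAs : HasBands As z x y)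
    (hs : ∀ i : ℤ, 1 ≤ i → i < n → s i = 1)
    (h : tridiagonalExpr β γ ρ As A = c₂ • (As * As) + c₁ • As + c₀ • 1)
    {k : ℤ} (hk : 0 ≤ k) (hkn : k + 1 < n) :
    y (k + 1) * (y (k + 2) - β * y (k + 1) + y k + (x k + x (k + 1)) * (θ k + θ (k + 1) - c₂) -
      β * (θ (k + 1) * x (k + 1) + θ k * x k) - γ * (θ k + θ (k + 1)) - c₁) = 0 := by
  have e := rowExt_relation h (k) ⟨(k + 1).toNat, by omega⟩
  simp only [hA.rowExt_mul, hAs.rowExt_mul, hA.rowExt_eq, hAs.rowExt_eq, rowExt_one,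
    Int.toNat_of_nonneg (show 0 ≤ k + 1 by omega), Pi.zero_apply, zero_mul, add_zero] at e
  simp (disch := omega) only [if_neg, if_pos, mul_zero, add_zero, mul_one, if_true, zero_add,
    sub_zero, hs] at e
  ring_nf at e ⊢
  have h1 : s k * y k = y k := mul_super hAs hs k
  have h2 : s (2 + k) * y (2 + k) = y (2 + k) := mul_super hAs hs (2 + k)
  linear_combination e - y (1 + k) * h1 - y (1 + k) * h2

theorem sub_invariant (hA : HasBands A s θ 0) (hAs : HasBands As z x y)
    (hs : ∀ i : ℤ, 1 ≤ i → i < n → s i = 1)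
    (h : tridiagonalExpr β γ ρ As A = c₂ • (As * As) + c₁ • As + c₀ • 1)
    {k : ℤ} (hk : 0 ≤ k) (hkn : k + 1 < n) :
    z (k + 1) * ((x (k + 1) + x k) * (θ (k + 1) + θ k - c₂) -
      β * (x (k + 1) * θ (k + 1) + θ k * x k + y k + y (k + 2)) -
      γ * (θ (k + 1) + θ k) - c₁ + 2 * y (k + 1)) +
      x (k + 1) ^ 2 + x k ^ 2 - β * x (k + 1) * x k + y (k + 2) * z (k + 2) + y k * z k -
      γ * (x (k + 1) + x k) = ρ := by
  have e := rowExt_relation h (k + 1) ⟨(k).toNat, by omega⟩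
  simp only [hA.rowExt_mul, hAs.rowExt_mul, hA.rowExt_eq, hAs.rowExt_eq, rowExt_one,
    Int.toNat_of_nonneg (show 0 ≤ k by omega), Pi.zero_apply, zero_mul, add_zero] at e
  simp (disch := omega) only [if_neg, if_pos, mul_zero, add_zero, mul_one, zero_add, hs] at e
  ring_nf at e ⊢
  have h1 : s k * y k = y k := mul_super hAs hs k
  have h2 : s (2 + k) * y (2 + k) = y (2 + k) := mul_super hAs hs (2 + k)
  linear_combination e + β * z (1 + k) * (h1 + h2)

end relations

theorem rowExt_mul_diagonal {F : Type*} [Field F] {n : ℕ} (M : Matrix (Fin n) (Fin n) F)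
    (t : Fin n → F) (m : ℤ) (j : Fin n) :
    rowExt (M * diagonal t) m j = rowExt M m j * t j := by
  rw [rowExt, rowExt, Finset.sum_mul]
  exact Finset.sum_congr rfl fun k _ => by rw [mul_diagonal]; split_ifs <;> simp

theorem sum_fin_eq_sum_int {F : Type*} [Field F] {n : ℕ} {f : ℤ → F} (S : Finset ℤ)
    (hS : ∀ m, m ∉ S → f m = 0) (hf : ∀ m, m < 0 ∨ (n : ℤ) ≤ m → f m = 0) :
    ∑ k : Fin n, f ((k : ℕ) : ℤ) = ∑ m ∈ S, f m := by
  have h1 : ∑ k : Fin n, f ((k : ℕ) : ℤ) = ∑ m ∈ S ∪ Finset.Ico 0 (n : ℤ), f m := by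
    refine Finset.sum_of_injOn (fun k : Fin n => ((k : ℕ) : ℤ)) ?_ ?_ ?_ fun _ _ => rfl
    · exact fun a _ b _ h => Fin.ext (by simpa using h)
    · intro k _
      simp
    · intro m _ hm
      refine hf m ?_
      by_contra hc
      exact hm ⟨⟨m.toNat, by omega⟩, Finset.mem_coe.2 (Finset.mem_univ _), by simp only; omega⟩
  rw [h1]
  exact (Finset.sum_subset Finset.subset_union_left fun m _ hm => hS m hm).symm

section diagonalization

variable {F : Type*} [Field F] {d : ℕ} {A As U V : Matrix (Fin (d + 1)) (Fin (d + 1)) F}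
  {s θ z x y : ℤ → F} {t : Fin (d + 1) → F}

theorem HasBands.right_recurrence (hA : HasBands A s θ 0) (hu : DiagonalizedBy A U V t)
    (m : ℤ) (j : Fin (d + 1)) :
    s m * rowExt U (m - 1) j =
      (t j - θ m) * rowExt U m j := by
  have e := hA.rowExt_mul U m j
  rw [hu.mul_right, rowExt_mul_diagonal, Pi.zero_apply] at e
  linear_combination -e

theorem HasBands.left_recurrence (hA : HasBands A s θ 0) (hu : DiagonalizedBy A U V t)
    (m : ℤ) (j : Fin (d + 1)) :
    s (m + 1) * rowExt Vᵀ (m + 1) j =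
      (t j - θ m) * rowExt Vᵀ m j := by
  have e := hA.transpose.rowExt_mul Vᵀ m j
  rw [← transpose_mul, hu.mul_left, transpose_mul, diagonal_transpose,
    rowExt_mul_diagonal, Pi.zero_apply] at e
  linear_combination -e

theorem DiagonalizedBy.sum_left_mul_right (hu : DiagonalizedBy A U V t) (i j : Fin (d + 1)) :
    ∑ k : Fin (d + 1), rowExt Vᵀ ((k : ℕ) : ℤ) i *
      rowExt U ((k : ℕ) : ℤ) j =
      (1 : Matrix (Fin (d + 1)) (Fin (d + 1)) F) i j := by
  rw [← hu.inv_mul, mul_apply]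
  simp only [rowExt_coe, transpose_apply]

theorem HasBands.conj_apply_eq_sum (hAs : HasBands As z x y) (i j : Fin (d + 1)) :
    (V * As * U) i j =
      ∑ k : Fin (d + 1), rowExt Vᵀ ((k : ℕ) : ℤ) i *
      (z (k : ℕ) * rowExt U ((k : ℕ) - 1) j +
        x (k : ℕ) * rowExt U (k : ℕ) j +
        y ((k : ℕ) + 1) * rowExt U ((k : ℕ) + 1) j) := by
  rw [Matrix.mul_assoc, mul_apply]
  exact Finset.sum_congr rfl fun k _ => by
    rw [← hAs.rowExt_mul, rowExt_coe, rowExt_coe, transpose_apply]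

theorem HasBands.exists_eq_diag (hA : HasBands A s θ 0)
    (hu : DiagonalizedBy A U V t) (j : Fin (d + 1)) :
    ∃ i : Fin (d + 1), t j = θ (i : ℕ) := by
  by_contra! hc
  have hzero : ∀ r : ℕ, r ≤ d → rowExt Vᵀ ((d : ℤ) - r) j = 0 := by
    have step : ∀ r : ℕ, r ≤ d → s ((d : ℤ) - r + 1) * rowExt Vᵀ ((d : ℤ) - r + 1) j = 0 →
        rowExt Vᵀ ((d : ℤ) - r) j = 0 := by
      intro r hr h
      rw [hA.left_recurrence hu] at h
      refine (mul_eq_zero.1 h).resolve_left ?_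
      have := hc ⟨d - r, by omega⟩
      rwa [← sub_ne_zero, Fin.val_mk, Nat.cast_sub hr] at this
    intro r
    induction r with
    | zero =>
      exact fun hr => step 0 hr (by
        rw [hA.sub_eq_zero _ (Or.inr (by push_cast; omega)), zero_mul])
    | succ r ih =>
      intro hr
      refine step (r + 1) hr ?_
      rw [Nat.cast_add, Nat.cast_one, ← sub_sub, sub_add_cancel, ih (by omega), mul_zero]
  have h1 := hu.sum_left_mul_right j j
  rw [one_apply_eq, Finset.sum_eq_zero] at h1
  · exact zero_ne_one h1
  · intro k _
    have := hzero (d - k) (by omega)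
    rw [Nat.cast_sub (by omega), sub_sub_cancel] at this
    rw [this, zero_mul]

theorem HasBands.right_eq_zero (hA : HasBands A s θ 0) (hs : ∀ i : ℤ, 1 ≤ i → i ≤ d → s i = 1)
    (hu : DiagonalizedBy A U V fun i => θ (i : ℕ)) {m : ℤ} {j : Fin (d + 1)}
    (hm : m < (j : ℕ)) : rowExt U m j = 0 := by
  have key : ∀ r : ℕ, rowExt U ((j : ℕ) - 1 - r) j = 0 := by
    have step : ∀ m : ℤ, m ≤ d →
        (θ (j : ℕ) - θ m) * rowExt U m j = 0 →
        rowExt U (m - 1) j = 0 := by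
      intro m hmd h
      by_cases h1 : 1 ≤ m
      · rw [← hA.right_recurrence hu, hs m h1 hmd, one_mul] at h
        exact h
      · exact rowExt_of_out _ _ _ (Or.inl (by omega))
    intro r
    have := j.2
    induction r with
    | zero => simpa using step (j : ℕ) (by omega) (by ring)
    | succ r ih =>
      have := step ((j : ℕ) - 1 - r) (by omega) (by rw [ih, mul_zero])
      rwa [Nat.cast_add, Nat.cast_one, ← sub_sub]
  have := key ((j : ℕ) - 1 - m).toNat
  rwa [Int.toNat_of_nonneg (by omega), sub_sub_cancel] at this

theorem HasBands.left_eq_zero (hA : HasBands A s θ 0) (hs : ∀ i : ℤ, 1 ≤ i → i ≤ d → s i = 1)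
    (hu : DiagonalizedBy A U V fun i => θ (i : ℕ)) {m : ℤ} {i : Fin (d + 1)}
    (hm : (i : ℕ) < m) :
    rowExt Vᵀ m i = 0 := by
  have key : ∀ r : ℕ,
      rowExt Vᵀ ((i : ℕ) + 1 + r) i = 0 := by
    have step : ∀ m : ℤ, 0 ≤ m → (θ (i : ℕ) - θ m) *
        rowExt Vᵀ m i = 0 →
        rowExt Vᵀ (m + 1) i = 0 := by
      intro m hmd h
      by_cases h1 : m + 1 ≤ d
      · rw [← hA.left_recurrence hu, hs (m + 1) (by omega) h1, one_mul] at h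
        exact h
      · exact rowExt_of_out _ _ _ (Or.inr (by push_cast; omega))
    intro r
    induction r with
    | zero => simpa using step (i : ℕ) (by omega) (by ring)
    | succ r ih =>
      have := step ((i : ℕ) + 1 + r) (by omega) (by rw [ih, mul_zero])
      rwa [Nat.cast_add, Nat.cast_one, ← add_assoc]
  have := key (m - 1 - (i : ℕ)).toNat
  rwa [Int.toNat_of_nonneg (by omega), show (i : ℕ) + 1 + (m - 1 - (i : ℕ)) = m by ring] at this

theorem HasBands.left_mul_right_self (hA : HasBands A s θ 0)
    (hs : ∀ i : ℤ, 1 ≤ i → i ≤ d → s i = 1)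
    (hu : DiagonalizedBy A U V fun i => θ (i : ℕ)) (i : Fin (d + 1)) :
    rowExt Vᵀ (i : ℕ) i *
      rowExt U (i : ℕ) i = 1 := by
  rw [← one_apply_eq (α := F) i, ← hu.sum_left_mul_right i i, Finset.sum_eq_single i]
  · intro k _ hk
    have hk' : (k : ℕ) ≠ i := fun h => hk (Fin.ext h)
    by_cases h : (k : ℕ) < i
    · rw [hA.right_eq_zero hs hu (by exact_mod_cast h), mul_zero]
    · rw [hA.left_eq_zero hs hu (by omega), zero_mul]
  · simp

theorem HasBands.conj_super_ne_zero (hA : HasBands A s θ 0) (hAs : HasBands As z x y)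
    (hs : ∀ i : ℤ, 1 ≤ i → i ≤ d → s i = 1) (hy : ∀ i : ℤ, 1 ≤ i → i ≤ d → y i ≠ 0)
    (hu : DiagonalizedBy A U V fun i => θ (i : ℕ)) {i j : Fin (d + 1)}
    (hij : (j : ℕ) = i + 1) : (V * As * U) i j ≠ 0 := by
  have hi := left_ne_zero_of_mul_eq_one (hA.left_mul_right_self hs hu i)
  have hj := right_ne_zero_of_mul_eq_one (hA.left_mul_right_self hs hu j)
  rw [hAs.conj_apply_eq_sum, Finset.sum_eq_single i]
  · rw [hA.right_eq_zero (j := j) hs hu (by omega), hA.right_eq_zero (j := j) hs hu (by omega)]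
    rw [hij, Nat.cast_add, Nat.cast_one] at hj
    have := hy (i + 1) (by omega) (by omega)
    simp [hi, hj, this]
  · intro k _ hk
    have hk' : (k : ℕ) ≠ i := fun h => hk (Fin.ext h)
    by_cases h : (k : ℕ) < i
    · rw [hA.right_eq_zero (j := j) hs hu (by omega), hA.right_eq_zero (j := j) hs hu (by omega),
        hA.right_eq_zero (j := j) hs hu (by omega)]
      simp
    · rw [hA.left_eq_zero hs hu (by omega), zero_mul]
  · simp

theorem HasBands.conj_sub_apply (hA : HasBands A s θ 0) (hAs : HasBands As z x y)
    (hs : ∀ i : ℤ, 1 ≤ i → i ≤ d → s i = 1)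
    (hu : DiagonalizedBy A U V fun i => θ (i : ℕ)) {i j : Fin (d + 1)}
    (hij : (i : ℕ) = j + 1) :
    ∃ ℓ w : ℤ → F, (V * As * U) i j = ℓ ((j : ℕ) - 1) * (y (j : ℕ) * w (j : ℕ)) +
      ℓ (j : ℕ) * (x (j : ℕ) * w (j : ℕ) + y ((j : ℕ) + 1) * w ((j : ℕ) + 1)) +
      ℓ ((j : ℕ) + 1) * (z ((j : ℕ) + 1) * w (j : ℕ) + x ((j : ℕ) + 1) * w ((j : ℕ) + 1) +
        y ((j : ℕ) + 2) * w ((j : ℕ) + 2)) ∧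
      (∀ m : ℤ, s (m + 1) * ℓ (m + 1) = (θ (i : ℕ) - θ m) * ℓ m) ∧
      (∀ m : ℤ, s m * w (m - 1) = (θ (j : ℕ) - θ m) * w m) := by
  refine ⟨fun m => rowExt Vᵀ m i,
    fun m => rowExt U m j, ?_,
    fun m => hA.left_recurrence hu m i, fun m => hA.right_recurrence hu m j⟩
  rw [hAs.conj_apply_eq_sum,
    sum_fin_eq_sum_int (f := fun k => rowExt Vᵀ k i *
      (z k * rowExt U (k - 1) j +
        x k * rowExt U k j +
        y (k + 1) * rowExt U (k + 1) j))
      {((j : ℕ) : ℤ) - 1, ((j : ℕ) : ℤ), ((j : ℕ) : ℤ) + 1}]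
  · rw [Finset.sum_insert (by simp; omega), Finset.sum_insert (by simp), Finset.sum_singleton]
    rw [hA.right_eq_zero hs hu (show ((j : ℕ) : ℤ) - 1 - 1 < (j : ℕ) by omega),
      hA.right_eq_zero hs hu (show ((j : ℕ) : ℤ) - 1 < (j : ℕ) by omega)]
    simp only [sub_add_cancel, add_sub_cancel_right, add_assoc, one_add_one_eq_two]
    ring
  · intro m hm
    simp only [Finset.mem_insert, Finset.mem_singleton, not_or] at hm
    by_cases h : m < (j : ℕ)
    · rw [hA.right_eq_zero (j := j) hs hu (by omega), hA.right_eq_zero (j := j) hs hu (by omega),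
        hA.right_eq_zero (j := j) hs hu (by omega)]
      simp
    · rw [hA.left_eq_zero hs hu (by omega), zero_mul]
  · intro m hm
    rw [rowExt_of_out _ _ _ (by push_cast; exact hm), zero_mul]

end diagonalization

theorem eq_add_mul_of_adjacent {d : ℕ} {f : ℕ → ℤ} (hf : ∀ i, i + 2 ≤ d → f (i + 2) ≠ f i)
    (h : ∀ i, i + 1 ≤ d → f (i + 1) = f i + 1 ∨ f i = f (i + 1) + 1) :
    (∀ i, i ≤ d → f i = f 0 + i) ∨ (∀ i, i ≤ d → f i = f 0 - i) := by
  rcases d with _ | d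
  · left
    intro i hi
    simp [Nat.le_zero.1 hi]
  · rcases h 0 (by omega) with h0 | h0
    · left
      have key : ∀ i, i + 1 ≤ d + 1 → f i = f 0 + i ∧ f (i + 1) = f 0 + i + 1 := by
        intro i
        induction i with
        | zero => simpa using h0
        | succ i ih =>
          intro hi
          have := ih (by omega)
          have : f (i + 1 + 1) ≠ f i := hf i hi
          have := h (i + 1) hi
          push_cast
          constructor <;> omega
      intro i hi
      rcases i with _ | i
      · simp
      · rw [(key i hi).2]; push_cast; ring
    · right
      have key : ∀ i, i + 1 ≤ d + 1 → f i = f 0 - i ∧ f (i + 1) = f 0 - i - 1 := by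
        intro i
        induction i with
        | zero => intro _; simp only [Nat.cast_zero, zero_add, sub_zero, true_and] at h0 ⊢; omega
        | succ i ih =>
          intro hi
          have := ih (by omega)
          have : f (i + 1 + 1) ≠ f i := hf i hi
          have := h (i + 1) hi
          push_cast
          constructor <;> omega
      intro i hi
      rcases i with _ | i
      · simp
      · rw [(key i hi).2]; push_cast; ring

theorem IsIrredTridiagonal.of_submatrix {F : Type*} [Field F] {d : ℕ}
    {T : Matrix (Fin (d + 1)) (Fin (d + 1)) F} (hT : IsIrredTridiagonal T)
    (τ : Equiv.Perm (Fin (d + 1)))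
    (h : ∀ i j : Fin (d + 1), (j : ℕ) = i + 1 → T.submatrix τ τ i j ≠ 0) :
    IsIrredTridiagonal (T.submatrix τ τ) := by
  have hadj : ∀ i j : Fin (d + 1), (j : ℕ) = i + 1 →
      (τ i : ℕ) = τ j + 1 ∨ (τ j : ℕ) = τ i + 1 := by
    intro i j hij
    by_contra hc
    have hne : (τ i : ℕ) ≠ τ j := fun e => by
      have := congrArg (fun k : Fin (d + 1) => (k : ℕ)) (τ.injective (Fin.ext e))
      omega
    exact h i j hij (hT.1 _ _ (by omega))
  obtain ⟨f, hf⟩ : ∃ f : ℕ → ℤ, ∀ i : Fin (d + 1), f i = (τ i : ℕ) :=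
    ⟨fun i => if hi : i < d + 1 then (τ ⟨i, hi⟩ : ℕ) else 0, fun i => by simp [i.2]⟩
  have hlin := eq_add_mul_of_adjacent (d := d) (f := f)
    (fun i hi e => by
      have h1 := hf ⟨i, by omega⟩
      have h2 := hf ⟨i + 2, by omega⟩
      simp only at h1 h2
      rw [e, h1, Nat.cast_inj] at h2
      have := congrArg (fun k : Fin (d + 1) => (k : ℕ)) (τ.injective (Fin.ext h2))
      simp only at this
      omega)
    (fun i hi => by
      have h1 := hf ⟨i, by omega⟩
      have h2 := hf ⟨i + 1, by omega⟩
      have := hadj ⟨i, by omega⟩ ⟨i + 1, by omega⟩ rfl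
      simp only at h1 h2
      omega)
  have hdist : ∀ i j : Fin (d + 1),
      ((τ i : ℕ) = τ j + 1 ∨ (τ j : ℕ) = τ i + 1 ↔ (i : ℕ) = j + 1 ∨ (j : ℕ) = i + 1) ∧
      ((τ i : ℕ) = τ j ↔ (i : ℕ) = j) := by
    intro i j
    have hi := hf i
    have hj := hf j
    rcases hlin with hl | hl <;>
    · rw [hl i (by omega)] at hi
      rw [hl j (by omega)] at hj
      omega
  refine ⟨fun i j hij => hT.1 _ _ ?_, fun i j hij => hT.2 _ _ ?_⟩
  · have := hdist i j
    omega
  · have := hdist i j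
    omega

theorem DiagonalizedBy.submatrix {F : Type*} [Field F] {n : ℕ} {A U V : Matrix (Fin n) (Fin n) F}
    {t : Fin n → F} (hu : DiagonalizedBy A U V t) (τ : Equiv.Perm (Fin n)) :
    DiagonalizedBy A (U.submatrix id τ) (V.submatrix τ id) (t ∘ τ) where
  inv_mul := by
    ext i j
    have := congrFun (congrFun hu.inv_mul (τ i)) (τ j)
    simpa [mul_apply, one_apply] using this
  mul_right := by
    ext i j
    have := congrFun (congrFun hu.mul_right i) (τ j)
    rw [mul_diagonal] at this ⊢
    exact this

theorem IsLeonardPair.exists_diagonalizedBy {F : Type*} [Field F] {n : ℕ}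
    {A As : Matrix (Fin n) (Fin n) F} (h : IsLeonardPair A As) :
    (∃ U V t, DiagonalizedBy As U V t ∧ IsIrredTridiagonal (V * A * U)) ∧
    (∃ U V t, DiagonalizedBy A U V t ∧ IsIrredTridiagonal (V * As * U)) := by
  have key : ∀ {A As P : Matrix (Fin n) (Fin n) F}, IsUnit P → (P⁻¹ * As * P).IsDiag →
      DiagonalizedBy As P P⁻¹ (P⁻¹ * As * P).diag := by
    intro A As P hP hd
    have hdet := (Matrix.isUnit_iff_isUnit_det P).1 hP
    refine ⟨Matrix.nonsing_inv_mul P hdet, ?_⟩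
    rw [hd.diagonal_diag, Matrix.mul_assoc, Matrix.mul_nonsing_inv_cancel_left P _ hdet]
  obtain ⟨⟨P, hP, hA, hAs⟩, Q, hQ, hAs', hA'⟩ := h
  exact ⟨⟨P, P⁻¹, _, key (A := A) hP hAs, hA⟩, Q, Q⁻¹, _, key (A := A) hQ hA', hAs'⟩

theorem DiagonalizedBy.conj {F : Type*} [Field F] {n : ℕ} {A U V U' V' : Matrix (Fin n) (Fin n) F}
    {t : Fin n → F} (hu : DiagonalizedBy A U V t) (h : V' * U' = 1) :
    DiagonalizedBy (V' * A * U') (V' * U) (V * U') t where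
  inv_mul := by
    rw [Matrix.mul_assoc, ← Matrix.mul_assoc U', mul_eq_one_comm.1 h, one_mul, hu.inv_mul]
  mul_right := by
    rw [Matrix.mul_assoc (V' * A), ← Matrix.mul_assoc U', mul_eq_one_comm.1 h, one_mul,
      Matrix.mul_assoc, hu.mul_right, Matrix.mul_assoc]

/-- A bidiagonal member of a Leonard pair can be diagonalized, keeping the order of its diagonal
entries, in such a way that the other member becomes irreducible tridiagonal. -/
theorem HasBands.exists_ordered_diagonalizedBy {F : Type*} [Field F] {d : ℕ}
    {A As : Matrix (Fin (d + 1)) (Fin (d + 1)) F} {s θ z x y : ℤ → F} (hA : HasBands A s θ 0)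
    (hAs : HasBands As z x y) (hs : ∀ i : ℤ, 1 ≤ i → i ≤ d → s i = 1)
    (hy : ∀ i : ℤ, 1 ≤ i → i ≤ d → y i ≠ 0) (h : IsLeonardPair A As) :
    Function.Injective (fun i : Fin (d + 1) => θ (i : ℕ)) ∧
    ∃ U V, DiagonalizedBy A U V (fun i => θ (i : ℕ)) ∧ IsIrredTridiagonal (V * As * U) := by
  obtain ⟨⟨U', V', t', ht', hirr'⟩, U, V, t, ht, hirr⟩ := h.exists_diagonalizedBy
  have htinj : Function.Injective t := hirr'.injective_of_diagonalizedBy (ht.conj ht'.inv_mul)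
  choose σ hσ using fun j => hA.exists_eq_diag ht j
  have hσinj : Function.Injective σ := fun i j e => htinj (by rw [hσ, hσ, e])
  obtain ⟨e, he⟩ : ∃ e : Equiv.Perm (Fin (d + 1)), ∀ i, e i = σ i :=
    ⟨Equiv.ofBijective σ (Finite.injective_iff_bijective.1 hσinj), fun _ => rfl⟩
  have hteq : (t ∘ e.symm) = fun i : Fin (d + 1) => θ (i : ℕ) := by
    funext i
    rw [Function.comp_apply, hσ, ← he, Equiv.apply_symm_apply]
  have hd := ht.submatrix e.symm
  rw [hteq] at hd
  refine ⟨hteq ▸ htinj.comp e.symm.injective, _, _, hd, ?_⟩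
  have hsub : V.submatrix e.symm id * As * U.submatrix id e.symm =
      (V * As * U).submatrix e.symm e.symm := rfl
  rw [hsub]
  refine hirr.of_submatrix e.symm fun i j hij => ?_
  rw [← hsub]
  exact hA.conj_super_ne_zero hAs hs hy hd hij

theorem tridiagonalExpr_apply_diagonal {F : Type*} [Field F] {n : ℕ} (β γ ρ : F) (t : Fin n → F)
    (H : Matrix (Fin n) (Fin n) F) (i j : Fin n) :
    tridiagonalExpr β γ ρ H (diagonal t) i j =
      ∑ k, H i k * H k j * (t i - β * t k + t j) - γ * ((t i + t j) * H i j) -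
        ρ * diagonal t i j := by
  simp only [tridiagonalExpr, Matrix.sub_apply, Matrix.add_apply, Matrix.smul_apply, smul_eq_mul,
    Matrix.mul_assoc, mul_diagonal, diagonal_mul]
  rw [← Matrix.mul_assoc, mul_diagonal, mul_apply, mul_apply, Finset.mul_sum, Finset.mul_sum,
    Finset.sum_mul]
  simp only [diagonal_mul]
  rw [← Finset.sum_sub_distrib, ← Finset.sum_add_distrib]
  congr 2
  · exact Finset.sum_congr rfl fun k _ => by ring
  · ring

theorem tridiagonalExpr_relation_of_diagonalizedBy {F : Type*} [Field F] {d : ℕ} (hd : 2 ≤ d)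
    {A As U V U' V' : Matrix (Fin (d + 1)) (Fin (d + 1)) F} {t ts : ℕ → F} {β γ : F}
    (hA : DiagonalizedBy A U V fun i => t i) (hAs : DiagonalizedBy As U' V' fun i => ts i)
    (hTAs : IsIrredTridiagonal (V * As * U)) (hTA : IsIrredTridiagonal (V' * A * U'))
    (ht : ∀ i, i + 2 ≤ d → t i - β * t (i + 1) + t (i + 2) = γ) :
    ∃ γs c₁ c₀ : F, tridiagonalExpr β γ (t 0 ^ 2 - β * t 0 * t 1 + t 1 ^ 2 - γ * (t 0 + t 1)) A As =
        γs • (A * A) + c₁ • A + c₀ • 1 ∧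
      ∀ i, i + 2 ≤ d → ts i - β * ts (i + 1) + ts (i + 2) = γs := by
  obtain ⟨ρ, hρ⟩ : ∃ ρ, ρ = t 0 ^ 2 - β * t 0 * t 1 + t 1 ^ 2 - γ * (t 0 + t 1) := ⟨_, rfl⟩
  rw [← hρ]
  obtain ⟨X, hX⟩ : ∃ X, X = tridiagonalExpr β γ ρ A As := ⟨_, rfl⟩
  obtain ⟨f, hf⟩ : ∃ f : Matrix (Fin (d + 1)) (Fin (d + 1)) F →ₐ[F]
      Matrix (Fin (d + 1)) (Fin (d + 1)) F, Function.Injective f ∧ ∀ M, f M = V * M * U :=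
    ⟨_, conjHom_injective ⟨U, V, mul_eq_one_comm.1 hA.inv_mul, hA.inv_mul⟩, fun _ => rfl⟩
  obtain ⟨g, hg⟩ : ∃ g : Matrix (Fin (d + 1)) (Fin (d + 1)) F →ₐ[F]
      Matrix (Fin (d + 1)) (Fin (d + 1)) F, Function.Injective g ∧ ∀ M, g M = V' * M * U' :=
    ⟨_, conjHom_injective ⟨U', V', mul_eq_one_comm.1 hAs.inv_mul, hAs.inv_mul⟩, fun _ => rfl⟩
  have hcomm : A * X = X * A := by
    refine hf.1 ?_
    have hfA : f A = diagonal fun i : Fin (d + 1) => t i := by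
      rw [hf.2, hA.mul_left, Matrix.mul_assoc, hA.inv_mul, mul_one]
    rw [map_mul, map_mul, hX, map_tridiagonalExpr, hfA, hf.2 As]
    refine hTAs.1.commute_tridiagonalExpr fun i hi => ?_
    rw [hρ]
    exact invariant_of_recurrence ht i (by omega)
  obtain ⟨H, hH⟩ : ∃ H, H = V' * A * U' := ⟨_, rfl⟩
  rw [← hH] at hTA
  have hgA : g A = H := by rw [hg.2, hH]
  have hgX : g X = tridiagonalExpr β γ ρ H (diagonal fun i : Fin (d + 1) => ts i) := by
    rw [hX, map_tridiagonalExpr, hgA, hg.2 As, hAs.mul_left, Matrix.mul_assoc, hAs.inv_mul,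
      mul_one]
  obtain ⟨c₂, c₁, c₀, hc⟩ := hTA.exists_quadratic (M := g X) hd
    (by rw [← hgA, ← map_mul, hcomm, map_mul]) (fun i hi => by
      have hz : ((0 : Fin (d + 1)) : ℕ) = 0 := rfl
      rw [hgX, tridiagonalExpr_apply_diagonal, hTA.1 i 0 (by omega),
        diagonal_apply_ne _ (by rintro rfl; omega), Finset.sum_eq_zero]
      · ring
      · intro k _
        by_cases hk : (k : ℕ) ≤ 1
        · rw [hTA.1 i k (by omega), zero_mul, zero_mul]
        · rw [hTA.1 k 0 (by omega), mul_zero, zero_mul])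
  refine ⟨c₂, c₁, c₀, hg.1 ?_, fun i hi => ?_⟩
  · rw [← hX, hc, map_add, map_add, map_smul, map_smul, map_smul, map_mul, hgA, map_one]
  · have e := congrFun (congrFun (hgX.symm.trans hc) ⟨i, by omega⟩) ⟨i + 2, by omega⟩
    have hsingle : ∀ φ : Fin (d + 1) → F,
        ∑ k, H ⟨i, by omega⟩ k * H k ⟨i + 2, by omega⟩ * φ k =
        H ⟨i, by omega⟩ ⟨i + 1, by omega⟩ * H ⟨i + 1, by omega⟩ ⟨i + 2, by omega⟩ *
          φ ⟨i + 1, by omega⟩ := by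
      intro φ
      rw [Finset.sum_eq_single ⟨i + 1, by omega⟩]
      · intro k _ hk
        have hk' : (k : ℕ) ≠ i + 1 := fun h => hk (Fin.ext h)
        by_cases hki : (k : ℕ) ≤ i
        · rw [hTA.1 k ⟨i + 2, by omega⟩ (by simp only; omega), mul_zero, zero_mul]
        · rw [hTA.1 ⟨i, by omega⟩ k (by simp only; omega), zero_mul, zero_mul]
      · simp
    have hHH : (H * H) ⟨i, by omega⟩ ⟨i + 2, by omega⟩ =
        H ⟨i, by omega⟩ ⟨i + 1, by omega⟩ * H ⟨i + 1, by omega⟩ ⟨i + 2, by omega⟩ := by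
      simpa [mul_apply] using hsingle fun _ => 1
    rw [tridiagonalExpr_apply_diagonal, hsingle fun k => ts i - β * ts k + ts (i + 2)] at e
    simp only [Matrix.add_apply, Matrix.smul_apply, smul_eq_mul, hHH] at e
    rw [hTA.1 ⟨i, by omega⟩ ⟨i + 2, by omega⟩ (by simp only; omega),
      diagonal_apply_ne _ (by simp [Fin.ext_iff]), one_apply_ne (by simp [Fin.ext_iff])] at e
    have h1 : H ⟨i, by omega⟩ ⟨i + 1, by omega⟩ ≠ 0 := hTA.2 _ _ (Or.inr rfl)
    have h2 : H ⟨i + 1, by omega⟩ ⟨i + 2, by omega⟩ ≠ 0 := hTA.2 _ _ (Or.inr rfl)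
    refine mul_left_cancel₀ (mul_ne_zero h1 h2) ?_
    linear_combination e

section sequences

variable {F : Type*} [Field F] {p : F} {W : ℕ → F} {d : ℕ}

theorem eq_closedForm_of_recurrence (hp : p ≠ 0) (hp4 : p ^ 4 ≠ 1)
    (hW : ∀ i, W i = p ^ 2 * W (i + 1))
    (hW0 : ∀ i, W i ≠ 0) {t : ℕ → F} {α : F}
    (ht : ∀ i, i + 2 ≤ d → t i - (p ^ 2 + (p ^ 2)⁻¹) * t (i + 1) + t (i + 2) =
      α * (2 - (p ^ 2 + (p ^ 2)⁻¹))) :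
    ∃ a a' : F, ∀ i, i ≤ d → t i = α + a * (W i)⁻¹ + a' * W i := by
  have hp4' : p ^ 4 - 1 ≠ 0 := sub_ne_zero.2 hp4
  have h1 := hW0 1
  have key : ∃ a a' : F, t 0 = α + a * (W 0)⁻¹ + a' * W 0 ∧ t 1 = α + a * (W 1)⁻¹ + a' * W 1 := by
    refine ⟨p ^ 2 * W 1 * (p ^ 2 * (t 1 - α) - (t 0 - α)) / (p ^ 4 - 1),
      (p ^ 2 * (t 0 - α) - (t 1 - α)) / ((p ^ 4 - 1) * W 1), ?_, ?_⟩
    · rw [hW 0]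
      field_simp
      ring
    · field_simp
      ring
  obtain ⟨a, a', ha0, ha1⟩ := key
  refine ⟨a, a', ?_⟩
  have hrec : ∀ i, i + 1 ≤ d → t i = α + a * (W i)⁻¹ + a' * W i ∧
      t (i + 1) = α + a * (W (i + 1))⁻¹ + a' * W (i + 1) := by
    intro i
    induction i with
    | zero => exact fun _ => ⟨ha0, ha1⟩
    | succ i ih =>
      intro hi
      obtain ⟨e0, e1⟩ := ih (by omega)
      refine ⟨e1, ?_⟩
      have e2 := ht i hi
      have := hW0 (i + 2)
      rw [e0, e1, hW i, hW (i + 1)] at e2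
      simp only [add_assoc, one_add_one_eq_two] at e2 ⊢
      rw [← sub_eq_iff_eq_add'.2 e2.symm]
      field_simp
      ring
  intro i hi
  rcases i with _ | i
  · exact ha0
  · exact (hrec i hi).2

theorem exists_geometric {q : F} (hq : q ≠ 0) (hq8 : q ^ 8 ≠ 1) {z : ℕ → F} (hd : 3 ≤ d)
    (hz : z 1 ≠ 0)
    (h₁ : ∀ k, k + 3 ≤ d → z (k + 1) - (q ^ 2 + (q ^ 2)⁻¹) * z (k + 2) + z (k + 3) = 0)
    (h₂ : z 3 * z 2 - (q ^ 2 + (q ^ 2)⁻¹) * (z 3 * z 1) + z 2 * z 1 = 0) :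
    ∃ p : F, (p = q ∨ p = q⁻¹) ∧ ∀ k, k + 2 ≤ d → z (k + 1) = p ^ 2 * z (k + 2) := by
  have hβ : q ^ 4 + 1 ≠ 0 := fun h => hq8 (by linear_combination (q ^ 4 - 1) * h)
  have h3 := h₁ 0 hd
  simp only [zero_add] at h3
  have hfac : (q ^ 4 + 1) * ((q ^ 2 * z 2 - z 1) * (z 2 - q ^ 2 * z 1)) = 0 := by
    have e3 : z 3 = (q ^ 2 + (q ^ 2)⁻¹) * z 2 - z 1 := by linear_combination h3
    rw [e3] at h₂
    field_simp at h₂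
    linear_combination h₂
  have hor : ∃ p : F, (p = q ∨ p = q⁻¹) ∧ z 1 = p ^ 2 * z 2 := by
    rcases mul_eq_zero.1 ((mul_eq_zero.1 hfac).resolve_left hβ) with h | h
    · exact ⟨q, Or.inl rfl, by linear_combination -h⟩
    · refine ⟨q⁻¹, Or.inr rfl, ?_⟩
      rw [sub_eq_zero.1 h]
      field_simp
  obtain ⟨p, hpq, hp1⟩ := hor
  refine ⟨p, hpq, fun k => ?_⟩
  have hpp : p ≠ 0 ∧ q ^ 2 + (q ^ 2)⁻¹ = p ^ 2 + (p ^ 2)⁻¹ := by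
    rcases hpq with rfl | rfl
    · exact ⟨hq, rfl⟩
    · exact ⟨inv_ne_zero hq, by rw [inv_pow, inv_inv, add_comm]⟩
  induction k with
  | zero => exact fun _ => hp1
  | succ k ih =>
    intro hk
    have e := h₁ k (by omega)
    rw [ih (by omega), hpp.2] at e
    have hp0 := hpp.1
    field_simp at e
    linear_combination -e

theorem diag_eq_of_recurrence (hp : p ≠ 0) (hp6 : p ^ 6 ≠ 1) (hW : ∀ i, W i = p ^ 2 * W (i + 1))
    (hW0 : ∀ i, W i ≠ 0) {θ x z : ℕ → F} {α αs a a' c E : F} (hc : c ≠ 0) (hd : 2 ≤ d)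
    (hθ : ∀ i, i ≤ d → θ i = α + a * (W i)⁻¹ + a' * W i)
    (hz : ∀ i, 1 ≤ i → i ≤ d → z i = -(c * (p * W i)))
    (h₁ : ∀ k, k + 2 ≤ d → (θ (k + 2) + θ (k + 1)) * z (k + 1) + x k -
      (p ^ 2 + (p ^ 2)⁻¹) * (θ (k + 2) * z (k + 2) + θ k * z (k + 1) + x (k + 1)) + x (k + 2) +
      z (k + 2) * (θ (k + 1) + θ k) -
      α * (2 - (p ^ 2 + (p ^ 2)⁻¹)) * (z (k + 1) + z (k + 2)) = αs * (2 - (p ^ 2 + (p ^ 2)⁻¹)))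
    (h₂ : z 2 * (x 2 + x 1 - (p ^ 2 + (p ^ 2)⁻¹) * x 0 - αs * (2 - (p ^ 2 + (p ^ 2)⁻¹))) +
      z 1 * (x 1 + x 0 - (p ^ 2 + (p ^ 2)⁻¹) * x 2 - αs * (2 - (p ^ 2 + (p ^ 2)⁻¹))) = 0) :
    ∃ s : F, ∀ i, i ≤ d →
      x i = αs + s * W i + a' * c * W i * (E - W i * p⁻¹ - W i * p) := by
  obtain ⟨s, hs⟩ : ∃ s, x 0 = αs + s * W 0 + a' * c * W 0 * (E - W 0 * p⁻¹ - W 0 * p) := by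
    refine ⟨(x 0 - αs) / W 0 - a' * c * (E - W 0 * p⁻¹ - W 0 * p), ?_⟩
    have := hW0 0
    field_simp
    ring
  refine ⟨s, ?_⟩
  obtain ⟨δ, hδ⟩ : ∃ δ : ℕ → F, ∀ i,
      x i = αs + s * W i + a' * c * W i * (E - W i * p⁻¹ - W i * p) + δ i :=
    ⟨fun i => x i - (αs + s * W i + a' * c * W i * (E - W i * p⁻¹ - W i * p)), fun i => by ring⟩
  have hδ0 : δ 0 = 0 := by linear_combination hs - hδ 0
  have hδr : ∀ k, k + 2 ≤ d → δ k - (p ^ 2 + (p ^ 2)⁻¹) * δ (k + 1) + δ (k + 2) = 0 := by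
    intro k hk
    have e := h₁ k hk
    have := hW0 (k + 2)
    rw [hθ k (by omega), hθ (k + 1) (by omega), hθ (k + 2) hk, hz (k + 1) (by omega) (by omega),
      hz (k + 2) (by omega) hk, hδ k, hδ (k + 1), hδ (k + 2), hW k, hW (k + 1)] at e
    simp only [add_assoc, one_add_one_eq_two] at e
    generalize W (k + 2) = w, δ k = u, δ (k + 1) = v, δ (k + 2) = t at *
    field_simp at e ⊢
    refine mul_left_cancel₀ hp ?_
    linear_combination e
  have hδ1 : δ 1 = 0 := by
    have e := hδr 0 hd
    rw [hδ0, zero_sub, zero_add] at e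
    have e2 : δ 2 = (p ^ 2 + (p ^ 2)⁻¹) * δ 1 := by linear_combination e
    have := hW0 2
    rw [hz 1 le_rfl (by omega), hz 2 (by omega) hd, hδ 0, hδ 1, hδ 2, hδ0, e2, hW 0, hW 1] at h₂
    have hne : c * (p ^ 6 - 1) * W 2 ≠ 0 :=
      mul_ne_zero (mul_ne_zero hc (sub_ne_zero.2 hp6)) this
    refine (mul_eq_zero.1 (?_ : c * (p ^ 6 - 1) * W 2 * δ 1 = 0)).resolve_left hne
    simp only [zero_add, one_add_one_eq_two] at *
    generalize W 2 = w, δ 1 = v at *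
    field_simp at h₂
    refine mul_left_cancel₀ (pow_ne_zero 2 hp) ?_
    linear_combination h₂
  have hrec : ∀ i, i + 1 ≤ d → δ i = 0 ∧ δ (i + 1) = 0 := by
    intro i
    induction i with
    | zero => exact fun _ => ⟨hδ0, hδ1⟩
    | succ i ih =>
      intro hi
      obtain ⟨e0, e1⟩ := ih (by omega)
      have e2 := hδr i hi
      rw [e0, e1, mul_zero, sub_zero, zero_add] at e2
      exact ⟨e1, e2⟩
  intro i hi
  rw [hδ i]
  rcases i with _ | i
  · rw [hδ0, add_zero]
  · rw [(hrec i hi).2, add_zero]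

theorem zero_eq_pow_mul (hW : ∀ i, W i = p ^ 2 * W (i + 1)) (i : ℕ) : W 0 = p ^ (2 * i) * W i := by
  induction i with
  | zero => simp
  | succ i ih => rw [ih, hW i]; ring

theorem sq_eq_of_mul_eq_one (hp : p ≠ 0) (hW : ∀ i, W i = p ^ 2 * W (i + 1))
    (hWd : p * W (d + 1) * (p * W 0) = 1) : W 0 ^ 2 = p ^ (2 * d) := by
  refine mul_left_cancel₀ (pow_ne_zero 2 hp) ?_
  linear_combination p ^ 2 * W 0 * zero_eq_pow_mul hW (d + 1) + p ^ (2 * d) * p ^ 2 * hWd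

theorem super_eq_of_recurrence (hp : p ≠ 0) (hru : ∀ n : ℕ, 1 ≤ n → p ^ n ≠ 1)
    (hW : ∀ i, W i = p ^ 2 * W (i + 1))
    (hW0 : ∀ i, W i ≠ 0) (hWd : p * W (d + 1) * (p * W 0) = 1) (hd : 2 ≤ d)
    {θ x y : ℕ → F} {α αs a a' c c₁ s E : F} (hE : E = p * W 0 + (p * W 0)⁻¹)
    (hθ : ∀ i, i ≤ d → θ i = α + a * (W i)⁻¹ + a' * W i)
    (hx : ∀ i, i ≤ d → x i = αs + s * W i + a' * c * W i * (E - W i * p⁻¹ - W i * p))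
    (hy0 : y 0 = 0) (hyd : y (d + 1) = 0)
    (h : ∀ k, k + 1 ≤ d → y (k + 2) - (p ^ 2 + (p ^ 2)⁻¹) * y (k + 1) + y k +
      (x k + x (k + 1)) * (θ k + θ (k + 1) - α * (2 - (p ^ 2 + (p ^ 2)⁻¹))) -
      (p ^ 2 + (p ^ 2)⁻¹) * (θ (k + 1) * x (k + 1) + θ k * x k) -
      αs * (2 - (p ^ 2 + (p ^ 2)⁻¹)) * (θ k + θ (k + 1)) - c₁ = 0) :
    ∃ K : F, (∀ i, i ≤ d + 1 → y i = (E - (p * W i)⁻¹ - p * W i) *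
      (K - s * a' * (p * W i) + a' ^ 2 * c * (p * W i) ^ 2)) ∧
      c₁ = (2 - (p ^ 2 + (p ^ 2)⁻¹)) * (E * K + s * a' + a * (s + a' * c * E) - 2 * α * αs) := by
  have hp2 := sub_ne_zero.2 (hru 2 (by norm_num))
  have hp4 := sub_ne_zero.2 (hru 4 (by norm_num))
  have h0 := hW0 0
  have h1 := hW0 1
  have hW2 := hW0 2
  have hg1 : E - (p * W 1)⁻¹ - p * W 1 ≠ 0 := by
    have hne : (p ^ 2 - 1) * (p ^ (2 * d) - 1) ≠ 0 :=
      mul_ne_zero hp2 (sub_ne_zero.2 (hru _ (by omega)))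
    rw [← sq_eq_of_mul_eq_one hp hW hWd, hW 0] at hne
    rw [hE, hW 0]
    intro h
    field_simp at h
    exact hne (by linear_combination h)
  obtain ⟨K, hK⟩ : ∃ K : F, y 1 = (E - (p * W 1)⁻¹ - p * W 1) *
      (K - s * a' * (p * W 1) + a' ^ 2 * c * (p * W 1) ^ 2) :=
    ⟨y 1 / (E - (p * W 1)⁻¹ - p * W 1) + s * a' * (p * W 1) - a' ^ 2 * c * (p * W 1) ^ 2, by
      generalize E - (p * W 1)⁻¹ - p * W 1 = g at hg1
      field_simp
      ring⟩
  obtain ⟨ε, hε⟩ : ∃ ε : ℕ → F, ∀ i, y i = (E - (p * W i)⁻¹ - p * W i) *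
      (K - s * a' * (p * W i) + a' ^ 2 * c * (p * W i) ^ 2) + ε i :=
    ⟨fun i => y i - (E - (p * W i)⁻¹ - p * W i) *
      (K - s * a' * (p * W i) + a' ^ 2 * c * (p * W i) ^ 2), fun i => by ring⟩
  have hε0 : ε 0 = 0 := by
    have e := hε 0
    rw [hy0, hE, add_sub_cancel_right, sub_self, zero_mul, zero_add] at e
    exact e.symm
  have hε1 : ε 1 = 0 := by linear_combination hK - hε 1
  have hεd : ε (d + 1) = 0 := by
    have e := hε (d + 1)
    rw [hyd, hE, ← eq_inv_of_mul_eq_one_left hWd] at e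
    have : (p * W (d + 1))⁻¹ = p * W 0 := (eq_inv_of_mul_eq_one_right hWd).symm
    rw [this, add_sub_cancel_left, sub_self, zero_mul, zero_add] at e
    exact e.symm
  obtain ⟨C, hC⟩ : ∃ C, C = c₁ -
    (2 - (p ^ 2 + (p ^ 2)⁻¹)) * (E * K + s * a' + a * (s + a' * c * E) - 2 * α * αs) := ⟨_, rfl⟩
  have hεr : ∀ k, k + 1 ≤ d → ε (k + 2) - (p ^ 2 + (p ^ 2)⁻¹) * ε (k + 1) + ε k = C := by
    intro k hk
    have e := h k hk
    have := hW0 (k + 2)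
    rw [hθ k (by omega), hθ (k + 1) hk, hx k (by omega), hx (k + 1) hk, hε k, hε (k + 1),
      hε (k + 2), hW k, hW (k + 1)] at e
    rw [hC]
    simp only [add_assoc, one_add_one_eq_two] at e ⊢
    generalize W (k + 2) = w, ε k = u, ε (k + 1) = v, ε (k + 2) = t at *
    field_simp at e ⊢
    refine mul_left_cancel₀ (mul_ne_zero (pow_ne_zero 4 hp) this) ?_
    linear_combination e
  have hCε : ∀ i, i ≤ d → (p ^ 2 - 1) * (p ^ 4 - 1) * ε i * p ^ (2 * i) =
        C * p ^ 2 * (p ^ (2 * i) - 1) * (p ^ (2 * i) - p ^ 2) ∧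
      (p ^ 2 - 1) * (p ^ 4 - 1) * ε (i + 1) * p ^ (2 * i + 2) =
        C * p ^ 2 * (p ^ (2 * i + 2) - 1) * (p ^ (2 * i + 2) - p ^ 2) := by
    intro i
    induction i with
    | zero => exact fun _ => by simp [hε0, hε1]
    | succ i ih =>
      intro hi
      obtain ⟨e0, e1⟩ := ih (by omega)
      refine ⟨e1, ?_⟩
      have er := hεr i hi
      rw [show 2 * (i + 1) + 2 = 2 * i + 4 by ring, pow_add p]
      rw [pow_add p] at e1
      generalize p ^ (2 * i) = P at e0 e1
      field_simp at er
      linear_combination (p ^ 2 - 1) * (p ^ 4 - 1) * P * p ^ 2 * er + (p ^ 4 + 1) * e1 - p ^ 4 * e0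
  have hC0 : C = 0 := by
    have e := (hCε d le_rfl).2
    have h₁ := sub_ne_zero.2 (hru (2 * d + 2) (by omega))
    have h₂ := sub_ne_zero.2 (hru (2 * d) (by omega))
    rw [hεd, mul_zero, zero_mul,
      show p ^ (2 * d + 2) - p ^ 2 = p ^ 2 * (p ^ (2 * d) - 1) by ring] at e
    simpa [hp, h₁, h₂] using e.symm
  have hrec : ∀ i, i ≤ d → ε i = 0 ∧ ε (i + 1) = 0 := by
    intro i
    induction i with
    | zero => exact fun _ => ⟨hε0, hε1⟩
    | succ i ih =>
      intro hi
      obtain ⟨e0, e1⟩ := ih (by omega)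
      have e2 := hεr i hi
      rw [e0, e1, mul_zero, sub_zero, add_zero, hC0] at e2
      exact ⟨e1, e2⟩
  refine ⟨K, fun i hi => ?_, by linear_combination hC0 - hC⟩
  rw [hε i]
  rcases i with _ | i
  · rw [hε0, add_zero]
  · rw [(hrec i (by omega)).2, add_zero]

theorem mul_eq_of_invariant (hp : p ≠ 0) (hp4 : p ^ 4 ≠ 1) (hW : ∀ i, W i = p ^ 2 * W (i + 1))
    (hW0 : ∀ i, W i ≠ 0) {θ x y z t : ℕ → F} {α αs a a' c c₁ s E K B B' : F}
    (hE : E = p * W 0 + (p * W 0)⁻¹) (hd : 2 ≤ d)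
    (hθ : ∀ i, i ≤ d → θ i = α + a * (W i)⁻¹ + a' * W i)
    (hx : ∀ i, i ≤ d → x i = αs + s * W i + a' * c * W i * (E - W i * p⁻¹ - W i * p))
    (hy0 : y 0 = 0)
    (hy : ∀ i, i ≤ d + 1 → y i = (E - (p * W i)⁻¹ - p * W i) *
      (K - s * a' * (p * W i) + a' ^ 2 * c * (p * W i) ^ 2))
    (hc₁ : c₁ = (2 - (p ^ 2 + (p ^ 2)⁻¹)) * (E * K + s * a' + a * (s + a' * c * E) - 2 * α * αs))
    (hz : ∀ i, 1 ≤ i → i ≤ d → z i = -(c * (p * W i)))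
    (ht : ∀ i, i ≤ d → t i = αs + B * (W i)⁻¹ + B' * W i)
    (h : z 1 * ((x 1 + x 0) * (θ 1 + θ 0 - α * (2 - (p ^ 2 + (p ^ 2)⁻¹))) -
      (p ^ 2 + (p ^ 2)⁻¹) * (x 1 * θ 1 + θ 0 * x 0 + y 0 + y 2) -
      αs * (2 - (p ^ 2 + (p ^ 2)⁻¹)) * (θ 1 + θ 0) - c₁ + 2 * y 1) +
      x 1 ^ 2 + x 0 ^ 2 - (p ^ 2 + (p ^ 2)⁻¹) * x 1 * x 0 + y 2 * z 2 + y 0 * z 0 -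
      αs * (2 - (p ^ 2 + (p ^ 2)⁻¹)) * (x 1 + x 0) =
      t 0 ^ 2 - (p ^ 2 + (p ^ 2)⁻¹) * t 0 * t 1 + t 1 ^ 2 -
        αs * (2 - (p ^ 2 + (p ^ 2)⁻¹)) * (t 0 + t 1)) :
    c * K = B * B' := by
  have hw := hW0 2
  rw [hy0, hθ 0 (by omega), hθ 1 (by omega), hx 0 (by omega), hx 1 (by omega), hy 1 (by omega),
    hy 2 (by omega), hz 1 le_rfl (by omega), hz 2 (by omega) hd, ht 0 (by omega), ht 1 (by omega),
    hc₁, hE, hW 0, hW 1] at h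
  simp only [one_add_one_eq_two] at h
  generalize W 2 = w at *
  field_simp at h
  refine mul_left_cancel₀ (mul_ne_zero (mul_ne_zero (pow_ne_zero 4 hp) (pow_ne_zero 2 hw))
    (pow_ne_zero 2 (sub_ne_zero.2 hp4))) ?_
  linear_combination -h

theorem sum_closedForm (hp : p ≠ 0) (hW : ∀ i, W i = p ^ 2 * W (i + 1))
    (hW0 : ∀ i, W i ≠ 0) (hWd : p * W (d + 1) * (p * W 0) = 1) (α a a' : F) :
    (p ^ 2 - 1) * ∑ i ∈ Finset.range (d + 1), (α + a * (W i)⁻¹ + a' * W i) =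
      (p ^ 2 - 1) * ((d + 1 : ℕ) * α) + (a + a') * (p ^ 2 * (W 0 - W (d + 1))) := by
  have h₁ : (p ^ 2 - 1) * ∑ i ∈ Finset.range (d + 1), (W i)⁻¹ = p ^ 2 * (W 0 - W (d + 1)) := by
    have e : ∀ i, (p ^ 2 - 1) * (W i)⁻¹ = (W (i + 1))⁻¹ - (W i)⁻¹ := fun i => by
      have := hW0 (i + 1)
      rw [hW i]
      field_simp
    rw [Finset.mul_sum, Finset.sum_congr rfl fun i _ => e i,
      Finset.sum_range_sub fun i => (W i)⁻¹]
    have h0 := hW0 0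
    have h1 := hW0 (d + 1)
    field_simp
    linear_combination (W (d + 1) - W 0) * hWd
  have h₂ : (p ^ 2 - 1) * ∑ i ∈ Finset.range (d + 1), W i = p ^ 2 * (W 0 - W (d + 1)) := by
    have e : ∀ i, (p ^ 2 - 1) * W i = p ^ 2 * W i - p ^ 2 * W (i + 1) := fun i => by
      rw [hW i]
      ring
    rw [Finset.mul_sum, Finset.sum_congr rfl fun i _ => e i,
      Finset.sum_range_sub' fun i => p ^ 2 * W i]
    ring
  rw [Finset.sum_add_distrib, Finset.sum_add_distrib, ← Finset.mul_sum, ← Finset.mul_sum,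
    Finset.sum_const, Finset.card_range, nsmul_eq_mul]
  linear_combination a * h₁ + a' * h₂

theorem sum_closedForm_diag (hp : p ≠ 0) (hW : ∀ i, W i = p ^ 2 * W (i + 1))
    (hWd : p * W (d + 1) * (p * W 0) = 1) {E : F} (hE : E = p * W 0 + (p * W 0)⁻¹) (α s r : F) :
    (p ^ 2 - 1) * ∑ i ∈ Finset.range (d + 1), (α + s * W i + r * W i * (E - W i * p⁻¹ - W i * p)) =
      (p ^ 2 - 1) * ((d + 1 : ℕ) * α) + s * (p ^ 2 * (W 0 - W (d + 1))) := by
  have e : ∀ i, (p ^ 2 - 1) * (α + s * W i + r * W i * (E - W i * p⁻¹ - W i * p)) =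
      (p ^ 2 - 1) * α + ((s * p ^ 2 * W i + r * (p ^ 2 * E * W i - p ^ 3 * W i ^ 2)) -
        (s * p ^ 2 * W (i + 1) + r * (p ^ 2 * E * W (i + 1) - p ^ 3 * W (i + 1) ^ 2))) := by
    intro i
    rw [hW i]
    field_simp
    ring
  rw [Finset.mul_sum, Finset.sum_congr rfl fun i _ => e i, Finset.sum_add_distrib,
    Finset.sum_range_sub' fun i => s * p ^ 2 * W i + r * (p ^ 2 * E * W i - p ^ 3 * W i ^ 2),
    Finset.sum_const, Finset.card_range, nsmul_eq_mul, hE, ← eq_inv_of_mul_eq_one_left hWd]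
  ring

theorem sub_entry_identity (hp : p ≠ 0) (hp4 : p ^ 4 ≠ 1) {v a a' b b' c E : F} (hv : v ≠ 0)
    (hc : c ≠ 0) (ha : a * c = b * p * v) :
    (E - (p * (p ^ 2 * v))⁻¹ - p * (p ^ 2 * v)) * (b' - a' * c * (p * (p ^ 2 * v))) *
        (p ^ 3 / (p ^ 4 - 1)) * (a * (p ^ 2 * v)⁻¹ + a' * (p ^ 2 * v) - (a * v⁻¹ + a' * v)) +
      ((b + b') * (p ^ 2 * v) +
        a' * c * (p ^ 2 * v) * (E - p ^ 2 * v * p⁻¹ - p ^ 2 * v * p)) *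
        (a * (p ^ 2 * v)⁻¹ + a' * (p ^ 2 * v) - (a * v⁻¹ + a' * v)) +
      (E - (p * v)⁻¹ - p * v) * (b - a' * c * (p * v)) * (b' - a' * c * (p * v)) * c⁻¹ =
    (a * (p ^ 2 * v)⁻¹ + a' * (p ^ 2 * v) - (a * v⁻¹ + a' * v)) *
      (-(c * (p * v)) * (a * (p ^ 2 * v)⁻¹ + a' * (p ^ 2 * v) - (a * v⁻¹ + a' * v)) +
        (b + b') * v + a' * c * v * (E - v * p⁻¹ - v * p) -
        (E - (p * (v / p ^ 2))⁻¹ - p * (v / p ^ 2)) * (b' - a' * c * (p * (v / p ^ 2))) *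
          (p / (p ^ 4 - 1))) := by
  obtain rfl : a = b * p * v / c := by rw [← ha, mul_div_cancel_right₀ _ hc]
  have := sub_ne_zero.2 hp4
  field_simp
  ring

end sequences

/-- If `b * p * W (j + 1) = a * c`, then the `(j + 1, j)` entry of the second matrix vanishes in a
basis diagonalizing the first one. -/
theorem HasBands.conj_sub_apply_eq_zero {F : Type*} [Field F] {d : ℕ} {p : F} {W : ℤ → F}
    {A As U V : Matrix (Fin (d + 1)) (Fin (d + 1)) F} {s θ z x y : ℤ → F}
    (hA : HasBands A s θ 0) (hAs : HasBands As z x y) (hs : ∀ i : ℤ, 1 ≤ i → i ≤ d → s i = 1)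
    (hu : DiagonalizedBy A U V fun i => θ (i : ℕ)) (hp : p ≠ 0) (hp4 : p ^ 4 ≠ 1)
    (hW : ∀ i, W i = p ^ 2 * W (i + 1)) (hW0 : ∀ i, W i ≠ 0)
    (hWd : p * W (d + 1) * (p * W 0) = 1) {α αs a a' b b' c E : F} (hc : c ≠ 0)
    (hE : E = p * W 0 + (p * W 0)⁻¹)
    (hθ : ∀ i : ℤ, 0 ≤ i → i ≤ d → θ i = α + a * (W i)⁻¹ + a' * W i)
    (hx : ∀ i : ℤ, 0 ≤ i → i ≤ d →
      x i = αs + (b + b') * W i + a' * c * W i * (E - W i * p⁻¹ - W i * p))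
    (hy : ∀ i : ℤ, 0 ≤ i → i ≤ d + 1 → y i = (E - (p * W i)⁻¹ - p * W i) *
      (b - a' * c * (p * W i)) * (b' - a' * c * (p * W i)) * c⁻¹)
    (hz : ∀ i : ℤ, 1 ≤ i → i ≤ d → z i = -(c * (p * W i)))
    {i j : Fin (d + 1)} (hij : (i : ℕ) = j + 1) (ha : a * c = b * p * W ((j : ℕ) + 1)) :
    (V * As * U) i j = 0 := by
  obtain ⟨ℓ, w, e, hℓ, hw⟩ := hA.conj_sub_apply hAs hs hu hij
  have hi := i.2
  rw [e]
  rw [hij, Nat.cast_add, Nat.cast_one] at hℓ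
  obtain ⟨k, hk⟩ : ∃ k : ℤ, k = (j : ℕ) := ⟨_, rfl⟩
  rw [← hk] at ha hℓ ⊢
  simp only [← hk] at hw
  have hv := hW0 (k + 1)
  have hWk : W k = p ^ 2 * W (k + 1) := hW k
  have hWk' : W (k - 1) = p ^ 2 * (p ^ 2 * W (k + 1)) := by rw [hW (k - 1), sub_add_cancel, hWk]
  have hWk2 : W (k + 2) = W (k + 1) / p ^ 2 := by
    rw [hW (k + 1), add_assoc, one_add_one_eq_two]
    field_simp
  have hp4' := sub_ne_zero.2 hp4
  have ha' : a = b * p * W (k + 1) / c := by rw [← ha, mul_div_cancel_right₀ _ hc]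
  have hℓ1 : ℓ (k + 1) = (θ (k + 1) - θ k) * ℓ k := by
    rw [← hℓ, hs (k + 1) (by omega) (by omega), one_mul]
  have hw0 : w k = (θ k - θ (k + 1)) * w (k + 1) := by
    rw [← hw, hs (k + 1) (by omega) (by omega), one_mul, add_sub_cancel_right]
  have hℓ0 : ℓ (k - 1) * y k = (E - (p * (p ^ 2 * W (k + 1)))⁻¹ - p * (p ^ 2 * W (k + 1))) *
      (b' - a' * c * (p * (p ^ 2 * W (k + 1)))) * (p ^ 3 / (p ^ 4 - 1)) * ℓ k := by
    rcases eq_or_ne k 0 with hk0 | hk0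
    · have h0 : E - (p * W k)⁻¹ - p * W k = 0 := by
        rw [hE, hk0]
        ring
      rw [hy k (by omega) (by omega), ← hWk, h0]
      ring
    · have hℓk := hℓ (k - 1)
      rw [sub_add_cancel, hs k (by omega) (by omega), one_mul] at hℓk
      rw [hℓk, hy k (by omega) (by omega), hθ (k + 1) (by omega) (by omega),
        hθ (k - 1) (by omega) (by omega), hWk', hWk, ha']
      generalize W (k + 1) = v at *
      field_simp
      ring
  have hw2 : y (k + 2) * w (k + 2) =
      -((E - (p * (W (k + 1) / p ^ 2))⁻¹ - p * (W (k + 1) / p ^ 2)) *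
      (b' - a' * c * (p * (W (k + 1) / p ^ 2))) * (p / (p ^ 4 - 1))) * w (k + 1) := by
    rcases eq_or_ne (k + 1) d with hkd | hkd
    · have h0 : E - (p * W (k + 2))⁻¹ - p * W (k + 2) = 0 := by
        rw [show k + 2 = (d : ℤ) + 1 by omega, hE, ← eq_inv_of_mul_eq_one_right hWd,
          eq_inv_of_mul_eq_one_left hWd]
        ring
      rw [hy (k + 2) (by omega) (by omega), ← hWk2, h0]
      ring
    · have hwk := hw (k + 2)
      rw [hs (k + 2) (by omega) (by omega), one_mul, show k + 2 - 1 = k + 1 by ring] at hwk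
      rw [hwk, hy (k + 2) (by omega) (by omega), hθ (k + 2) (by omega) (by omega),
        hθ k (by omega) (by omega), hWk2, hWk, ha']
      generalize W (k + 1) = v at *
      field_simp
      ring
  have key := sub_entry_identity (a' := a') (b' := b') (E := E) hp hp4 hv hc ha
  have h1 := hx k (by omega) (by omega)
  have h2 := hx (k + 1) (by omega) (by omega)
  have h3 := hy (k + 1) (by omega) (by omega)
  have h4 := hz (k + 1) (by omega) (by omega)
  have hΔ : θ k - θ (k + 1) = a * (p ^ 2 * W (k + 1))⁻¹ + a' * (p ^ 2 * W (k + 1)) -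
      (a * (W (k + 1))⁻¹ + a' * W (k + 1)) := by
    rw [hθ k (by omega) (by omega), hθ (k + 1) (by omega) (by omega), hWk]
    ring
  rw [hWk] at h1
  rw [← mul_assoc, hℓ0, add_assoc _ _ (y (k + 2) * w (k + 2)), hw2, hℓ1,
    ← neg_sub (θ k), hw0, hΔ, h1, h2, h3, h4]
  linear_combination ℓ k * w (k + 1) * key

theorem DiagonalizedBy.trace_eq {F : Type*} [Field F] {n : ℕ} {A U V : Matrix (Fin n) (Fin n) F}
    {t : Fin n → F} (hu : DiagonalizedBy A U V t) : A.trace = ∑ i, t i := by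
  rw [← trace_diagonal, ← Matrix.one_mul (diagonal t), ← hu.inv_mul, Matrix.mul_assoc,
    ← hu.mul_right, trace_mul_comm, Matrix.mul_assoc, mul_eq_one_comm.1 hu.inv_mul, Matrix.mul_one]

section relations

variable {F : Type*} [Field F] {d : ℕ} {A As : Matrix (Fin (d + 1)) (Fin (d + 1)) F}
  {s θ z x y : ℤ → F}

theorem HasBands.isIrredTridiagonal (hAs : HasBands As z x y)
    (hyz : ∀ i : ℤ, 1 ≤ i → i ≤ d → y i * z i ≠ 0) : IsIrredTridiagonal As := by
  refine ⟨fun i j h => ?_, fun i j h => ?_⟩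
  · rw [hAs.apply, if_neg (by omega), if_neg (by omega), if_neg (by omega), add_zero, add_zero]
  · have hi := i.2
    have hj := j.2
    rcases h with h | h
    · rw [hAs.apply, if_pos (by omega), if_neg (by omega), if_neg (by omega), add_zero, add_zero]
      exact right_ne_zero_of_mul (hyz _ (by omega) (by omega))
    · rw [hAs.apply, if_neg (by omega), if_neg (by omega), if_pos (by omega), zero_add, zero_add]
      exact left_ne_zero_of_mul (hyz _ (by omega) (by omega))

theorem HasBands.trace_eq (hAs : HasBands As z x y) :
    As.trace = ∑ i ∈ Finset.range (d + 1), x i := by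
  rw [trace, Finset.sum_range]
  exact Finset.sum_congr rfl fun i _ => by
    rw [diag_apply, hAs.apply, if_neg (by omega), if_pos rfl, if_neg (by omega), zero_add, add_zero]

/-- A recurrence with constant right-hand side, obtained by summing a third order recurrence. -/
theorem exists_recurrence {β : F} {t : ℕ → F}
    (h : ∀ i, i + 3 ≤ d → t i - t (i + 3) = (β + 1) * (t (i + 1) - t (i + 2))) :
    ∃ γ, ∀ i, i + 2 ≤ d → t i - β * t (i + 1) + t (i + 2) = γ := by
  refine ⟨t 0 - β * t 1 + t 2, fun i => ?_⟩
  induction i with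
  | zero => exact fun _ => rfl
  | succ i ih =>
    intro hi
    rw [← ih (by omega)]
    linear_combination -h i (by omega)

/-- The relations between the members of a Leonard pair, in terms of the eigenvalues `t` of the
second one. -/
theorem HasBands.exists_relations (hd : 2 ≤ d) (hA : HasBands A s θ 0) (hAs : HasBands As z x y)
    (hs : ∀ i : ℤ, 1 ≤ i → i ≤ d → s i = 1)
    (hyz : ∀ i : ℤ, 1 ≤ i → i ≤ d → y i * z i ≠ 0) (hLP : IsLeonardPair A As) {β γ : F}
    (hγ : ∀ i : ℕ, i + 2 ≤ d → θ i - β * θ (i + 1 : ℕ) + θ (i + 2 : ℕ) = γ) :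
    ∃ (t : ℕ → F) (γs c₁ c₀ e₁ e₀ ρ : F),
      (∀ i j, i ≤ d → j ≤ d → t i = t j → i = j) ∧
      ∑ i ∈ Finset.range (d + 1), t i = ∑ i ∈ Finset.range (d + 1), x i ∧
      (∀ i, i + 2 ≤ d → t i - β * t (i + 1) + t (i + 2) = γs) ∧
      tridiagonalExpr β γ ρ A As = γs • (A * A) + c₁ • A + c₀ • 1 ∧
      tridiagonalExpr β γs (t 0 ^ 2 - β * t 0 * t 1 + t 1 ^ 2 - γs * (t 0 + t 1)) As A =
        γ • (As * As) + e₁ • As + e₀ • 1 := by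
  obtain ⟨-, U, V, hu, hirr⟩ := hA.exists_ordered_diagonalizedBy hAs hs
    (fun i h₁ h₂ => left_ne_zero_of_mul (hyz i h₁ h₂)) hLP
  obtain ⟨⟨U', V', t', ht', hirr'⟩, -⟩ := hLP.exists_diagonalizedBy
  obtain ⟨t, rfl⟩ : ∃ t : ℕ → F, t' = fun i : Fin (d + 1) => t i :=
    ⟨fun i => t' (Fin.ofNat (d + 1) i), by simp⟩
  have hinj := (hAs.isIrredTridiagonal hyz).injective_of_diagonalizedBy ht'
  obtain ⟨γs, c₁, c₀, h₁, hγs⟩ := tridiagonalExpr_relation_of_diagonalizedBy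
    (t := fun i : ℕ => θ i) hd hu ht' hirr hirr' hγ
  obtain ⟨γ', e₁, e₀, h₂, hγ'⟩ := tridiagonalExpr_relation_of_diagonalizedBy
    (ts := fun i : ℕ => θ i) hd ht' hu hirr' hirr hγs
  obtain rfl : γ' = γ := (hγ' 0 hd).symm.trans (hγ 0 hd)
  refine ⟨t, γs, c₁, c₀, e₁, e₀, _, fun i j hi hj e => ?_, ?_, hγs, h₁, h₂⟩
  · exact congrArg Fin.val (@hinj ⟨i, by omega⟩ ⟨j, by omega⟩ e)
  · rw [← hAs.trace_eq, ht'.trace_eq, Finset.sum_range]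

end relations

section parameters

variable {F : Type*} [Field F] {d : ℕ} {A As : Matrix (Fin (d + 1)) (Fin (d + 1)) F}
  {s θ z x y : ℤ → F}

theorem exists_eq_neg_mul_of_geometric {p : F} (hp : p ≠ 0) {W z : ℕ → F}
    (hW : ∀ i, W i = p ^ 2 * W (i + 1)) (hW0 : ∀ i, W i ≠ 0) (hz1 : z 1 ≠ 0)
    (hz : ∀ k, k + 2 ≤ d → z (k + 1) = p ^ 2 * z (k + 2)) :
    ∃ c : F, c ≠ 0 ∧ ∀ i, 1 ≤ i → i ≤ d → z i = -(c * (p * W i)) := by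
  have h1 := hW0 1
  refine ⟨-(z 1 / (p * W 1)), neg_ne_zero.2 (div_ne_zero hz1 (mul_ne_zero hp h1)), ?_⟩
  intro i hi
  induction i, hi using Nat.le_induction with
  | base =>
    intro
    field_simp
  | succ i hi ih =>
    intro hid
    obtain ⟨k, rfl⟩ : ∃ k, i = k + 1 := ⟨i - 1, by omega⟩
    refine mul_left_cancel₀ (pow_ne_zero 2 hp) ?_
    rw [← hz k hid, ih (by omega), hW (k + 1)]
    ring

/-- The closed forms of the entries and of the eigenvalues `t`, given the relations. -/
theorem HasBands.exists_parameters (hd : 3 ≤ d) (hA : HasBands A s θ 0) (hAs : HasBands As z x y)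
    (hs : ∀ i : ℤ, 1 ≤ i → i ≤ d → s i = 1)
    (hyz : ∀ i : ℤ, 1 ≤ i → i ≤ d → y i * z i ≠ 0)
    {q : F} (hq : q ≠ 0) (hqru : ∀ n : ℕ, 1 ≤ n → q ^ n ≠ 1) {t : ℕ → F}
    {γ γs c₁ c₀ e₁ e₀ ρ : F}
    (hθ : ∀ i : ℕ, i + 2 ≤ d → θ i - (q ^ 2 + (q ^ 2)⁻¹) * θ (i + 1 : ℕ) + θ (i + 2 : ℕ) = γ)
    (ht : ∀ i, i + 2 ≤ d → t i - (q ^ 2 + (q ^ 2)⁻¹) * t (i + 1) + t (i + 2) = γs)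
    (htr : ∑ i ∈ Finset.range (d + 1), t i = ∑ i ∈ Finset.range (d + 1), x i)
    (hAAs : tridiagonalExpr (q ^ 2 + (q ^ 2)⁻¹) γ ρ A As = γs • (A * A) + c₁ • A + c₀ • 1)
    (hAsA : tridiagonalExpr (q ^ 2 + (q ^ 2)⁻¹) γs
      (t 0 ^ 2 - (q ^ 2 + (q ^ 2)⁻¹) * t 0 * t 1 + t 1 ^ 2 - γs * (t 0 + t 1)) As A =
        γ • (As * As) + e₁ • As + e₀ • 1) :
    ∃ p : F, (p = q ∨ p = q⁻¹) ∧ ∃ W : ℤ → F, (∀ i, W i = p ^ ((d : ℤ) - 2 * i)) ∧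
      ∃ α αs a a' b b' c E : F, c ≠ 0 ∧ E = p * W 0 + (p * W 0)⁻¹ ∧
        (∀ i : ℕ, i ≤ d → θ i = α + a * (W i)⁻¹ + a' * W i) ∧
        (∀ i : ℕ, i ≤ d → t i = αs + b * (W i)⁻¹ + b' * W i) ∧
        (∀ i : ℕ, i ≤ d →
          x i = αs + (b + b') * W i + a' * c * W i * (E - W i * p⁻¹ - W i * p)) ∧
        (∀ i : ℕ, i ≤ d + 1 → y i = (E - (p * W i)⁻¹ - p * W i) *
          (b - a' * c * (p * W i)) * (b' - a' * c * (p * W i)) * c⁻¹) ∧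
        (∀ i : ℕ, 1 ≤ i → i ≤ d → z i = -(c * (p * W i))) := by
  have hs' : ∀ i : ℤ, 1 ≤ i → i < (d + 1 : ℕ) → s i = 1 := fun i h₁ h₂ => hs i h₁ (by omega)
  obtain ⟨p, hpq, hgeo⟩ := exists_geometric (z := fun i : ℕ => z i) hq (hqru 8 (by norm_num)) hd
    (right_ne_zero_of_mul (hyz _ (by norm_num) (by norm_cast; omega)))
    (fun k hk => by
      exact_mod_cast sub_recurrence hA hAs hs' hAAs (k := k) (by omega) (by omega))
    (by exact_mod_cast inv_sub_recurrence hA hAs hs' hAsA (k := 0) le_rfl (by omega))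
  have hp : p ≠ 0 := by
    rcases hpq with rfl | rfl
    exacts [hq, inv_ne_zero hq]
  have hpru : ∀ n : ℕ, 1 ≤ n → p ^ n ≠ 1 := by
    intro n hn
    rcases hpq with rfl | rfl
    · exact hqru n hn
    · rw [inv_pow, Ne, inv_eq_one]
      exact hqru n hn
  have hβ : q ^ 2 + (q ^ 2)⁻¹ = p ^ 2 + (p ^ 2)⁻¹ := by
    rcases hpq with rfl | rfl
    · rfl
    · rw [inv_pow, inv_inv, add_comm]
  rw [hβ] at hθ ht hAAs hAsA
  have hβ2 : 2 - (p ^ 2 + (p ^ 2)⁻¹) ≠ 0 := by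
    have h := pow_ne_zero 2 (sub_ne_zero.2 (hpru 2 (by norm_num)))
    intro h0
    field_simp at h0
    exact h (by linear_combination -h0)
  obtain ⟨α, rfl⟩ : ∃ α, γ = α * (2 - (p ^ 2 + (p ^ 2)⁻¹)) := ⟨_, (div_mul_cancel₀ γ hβ2).symm⟩
  obtain ⟨αs, rfl⟩ : ∃ αs, γs = αs * (2 - (p ^ 2 + (p ^ 2)⁻¹)) :=
    ⟨_, (div_mul_cancel₀ γs hβ2).symm⟩
  obtain ⟨W, hWdef⟩ : ∃ W : ℤ → F, ∀ i, W i = p ^ ((d : ℤ) - 2 * i) := ⟨_, fun _ => rfl⟩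
  have hW : ∀ i : ℕ, W i = p ^ 2 * W (i + 1 : ℕ) := fun i => by
    rw [hWdef, hWdef, ← zpow_natCast, ← zpow_add₀ hp]
    congr 1
    push_cast
    ring
  have hW0 : ∀ i : ℕ, W i ≠ 0 := fun i => by
    rw [hWdef]
    exact zpow_ne_zero _ hp
  have hWd : p * W (d + 1 : ℕ) * (p * W (0 : ℕ)) = 1 := by
    rw [hWdef, hWdef, ← zpow_one_add₀ hp, ← zpow_one_add₀ hp, ← zpow_add₀ hp]
    convert zpow_zero p using 2
    push_cast
    ring
  obtain ⟨E, hE⟩ : ∃ E, E = p * W (0 : ℕ) + (p * W (0 : ℕ))⁻¹ := ⟨_, rfl⟩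
  obtain ⟨c, hc, hz⟩ := exists_eq_neg_mul_of_geometric (W := fun i : ℕ => W i)
    (z := fun i : ℕ => z i) hp hW hW0
    (right_ne_zero_of_mul (hyz _ (by norm_num) (by norm_cast; omega))) hgeo
  obtain ⟨a, a', hθ'⟩ := eq_closedForm_of_recurrence (W := fun i : ℕ => W i)
    (t := fun i : ℕ => θ i) hp (hpru 4 (by norm_num)) hW hW0 hθ
  obtain ⟨b, b', ht'⟩ := eq_closedForm_of_recurrence (W := fun i : ℕ => W i)
    hp (hpru 4 (by norm_num)) hW hW0 ht
  obtain ⟨r, hx⟩ := diag_eq_of_recurrence (W := fun i : ℕ => W i) (x := fun i : ℕ => x i)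
    (z := fun i : ℕ => z i) (E := E) hp (hpru 6 (by norm_num)) hW hW0 hc (by omega) hθ' hz
    (fun k hk => by
      exact_mod_cast diag_recurrence hA hAs hs' hAAs (k := k) (by omega) (by omega))
    (by
      have e := diag_sub_recurrence hA hAs hs' hAsA (k := 0) le_rfl (by omega)
      have e' := hθ 0 (by omega)
      norm_num at e e' ⊢
      linear_combination e - z 2 * z 1 * e')
  have hy0 : y (0 : ℕ) = 0 := hAs.super_eq_zero _ (by simp)
  have hyd : y (d + 1 : ℕ) = 0 := hAs.super_eq_zero _ (by simp)
  obtain ⟨K, hy, he₁⟩ := super_eq_of_recurrence (W := fun i : ℕ => W i) (x := fun i : ℕ => x i)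
    (y := fun i : ℕ => y i) (c₁ := e₁) hp hpru hW hW0 hWd (by omega) hE hθ' hx hy0 hyd
    (fun k hk => by
      have e := super_recurrence hA hAs hs' hAsA (k := k) (by omega) (by omega)
      have h := left_ne_zero_of_mul (hyz (k + 1) (by omega) (by omega))
      exact_mod_cast (mul_eq_zero.1 e).resolve_left h)
  have hr : r = b + b' := by
    have e₁ := sum_closedForm hp (W := fun i : ℕ => W i) hW hW0 hWd αs b b'
    have e₂ := sum_closedForm_diag hp (W := fun i : ℕ => W i) hW hWd hE αs r (a' * c)
    rw [← Finset.sum_congr rfl fun i hi => ht' i (by rw [Finset.mem_range] at hi; omega), htr,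
      Finset.sum_congr rfl fun i hi => hx i (by rw [Finset.mem_range] at hi; omega), e₂] at e₁
    have hne : p ^ 2 * (W (0 : ℕ) - W (d + 1 : ℕ)) ≠ 0 := by
      refine mul_ne_zero (pow_ne_zero 2 hp) ?_
      rw [zero_eq_pow_mul (W := fun i : ℕ => W i) hW (d + 1)]
      have := mul_ne_zero (sub_ne_zero.2 (hpru (2 * (d + 1)) (by omega))) (hW0 (d + 1))
      rwa [sub_one_mul] at this
    exact mul_right_cancel₀ hne (add_left_cancel e₁)
  have hK : c * K = b * b' := by
    refine mul_eq_of_invariant (W := fun i : ℕ => W i) (x := fun i : ℕ => x i)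
      (y := fun i : ℕ => y i) (z := fun i : ℕ => z i) hp (hpru 4 (by norm_num)) hW hW0 hE
      (by omega) hθ' hx hy0 hy he₁ hz ht' ?_
    exact_mod_cast sub_invariant hA hAs hs' hAsA (k := 0) le_rfl (by omega)
  refine ⟨p, hpq, W, hWdef, α, αs, a, a', b, b', c, E, hc, hE, hθ', ht', ?_, ?_, hz⟩
  · rw [← hr]
    exact hx
  · intro i hi
    obtain rfl : K = b * b' / c := by rw [← hK, mul_div_cancel_left₀ _ hc]
    rw [hy i hi, hr]
    field_simp
    ring

end parameters

section construction

variable {F : Type*} [Field F] {d : ℕ}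

/-- A finite sequence extended by zero outside of `1, …, d`. -/
def extendZero (d : ℕ) (z : ℕ → F) (m : ℤ) : F := if 1 ≤ m ∧ m ≤ d then z m.toNat else 0

theorem extendZero_natCast (z : ℕ → F) {i : ℕ} (h₁ : 1 ≤ i) (h₂ : i ≤ d) :
    extendZero d z i = z i := by
  rw [extendZero, if_pos (by omega), Int.toNat_natCast]

theorem hasBands_of_apply {T : Matrix (Fin (d + 1)) (Fin (d + 1)) F} {x y z : ℕ → F}
    (h : ∀ i j : Fin (d + 1), T i j =
      if (i : ℕ) = (j : ℕ) then x (i : ℕ)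
      else if (i : ℕ) = (j : ℕ) + 1 then z (i : ℕ)
      else if (j : ℕ) = (i : ℕ) + 1 then y (j : ℕ) else 0) :
    HasBands T (extendZero d z) (fun m => x m.toNat) (extendZero d y) where
  apply i j := by
    have hi := i.2
    have hj := j.2
    rw [h]
    by_cases h₁ : (i : ℕ) = j
    · simp (disch := omega) only [if_pos, if_neg, Int.toNat_natCast, zero_add, add_zero]
    · by_cases h₂ : (i : ℕ) = j + 1
      · simp (disch := omega) only [if_pos, if_neg, add_zero, extendZero_natCast]
      · by_cases h₃ : (j : ℕ) = i + 1
        · simp (disch := omega) only [if_pos, if_neg, zero_add]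
          rw [← Nat.cast_succ, Nat.succ_eq_add_one, ← h₃]
          exact (extendZero_natCast y (by omega) (by omega)).symm
        · simp (disch := omega) only [if_neg, add_zero]
  sub_eq_zero i hi := if_neg (by omega)
  super_eq_zero i hi := if_neg (by omega)

theorem ne_mul_zpow_of_injective {p : F} (hp : p ≠ 0) {W : ℤ → F}
    (hW : ∀ i, W i = p ^ ((d : ℤ) - 2 * i)) {t : ℕ → F} {α a a' : F}
    (ht : ∀ i : ℕ, i ≤ d → t i = α + a * (W i)⁻¹ + a' * W i)
    (hinj : ∀ i j, i ≤ d → j ≤ d → t i = t j → i = j) {j : ℕ} (h₁ : 1 ≤ j) (h₂ : j ≤ 2 * d - 1) :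
    a ≠ a' * p ^ (2 * (d : ℤ) - 2 * (j : ℤ)) := by
  intro h
  have key : ∀ i k : ℕ, i ≤ d → k ≤ d → i + k = j → i = k := by
    intro i k hi hk hik
    refine hinj i k hi hk ?_
    have hWW : a = a' * (W i * W k) := by
      rw [h, hW, hW, ← zpow_add₀ hp, ← hik]
      congr 2
      push_cast
      ring
    have hi0 : W i ≠ 0 := by
      rw [hW]
      exact zpow_ne_zero _ hp
    have hk0 : W k ≠ 0 := by
      rw [hW]
      exact zpow_ne_zero _ hp
    rw [ht i hi, ht k hk, hWW]
    field_simp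
    ring
  rcases le_or_gt j d with hj | hj
  · have := key j 0 hj (by omega) rfl
    omega
  · have := key d (j - d) le_rfl (by omega) (by omega)
    omega

end construction

end leonardPair

/-- Theorem 1.11 of the paper: every LB-TD Leonard pair with quantum parameter `q`
not a root of unity arises from the construction of Proposition 1.6, after possibly
replacing `q` by `q⁻¹`. -/
theorem stmt3 {F : Type*} [Field F] [IsAlgClosed F] {d : ℕ} (hd : 3 ≤ d)
    (θ x y z : ℕ → F)
    (hyz : ∀ i : ℕ, 1 ≤ i → i ≤ d → y i * z i ≠ 0)
    (A As : Matrix (Fin (d + 1)) (Fin (d + 1)) F)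
    (hA : ∀ i j : Fin (d + 1), A i j =
      if (i : ℕ) = (j : ℕ) then θ (i : ℕ)
      else if (i : ℕ) = (j : ℕ) + 1 then 1 else 0)
    (hAs : ∀ i j : Fin (d + 1), As i j =
      if (i : ℕ) = (j : ℕ) then x (i : ℕ)
      else if (i : ℕ) = (j : ℕ) + 1 then z (i : ℕ)
      else if (j : ℕ) = (i : ℕ) + 1 then y (j : ℕ) else 0)
    (hLP : IsLeonardPair A As)
    (q : F) (hq : q ≠ 0) (hqru : ∀ n : ℕ, 1 ≤ n → q ^ n ≠ 1)
    (hqp : ∀ i : ℕ, 2 ≤ i → i ≤ d - 1 →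
      θ (i - 2) - θ (i + 1) = (q ^ (2 : ℤ) + q ^ (-2 : ℤ) + 1) * (θ (i - 1) - θ i)) :
    ∃ p : F, (p = q ∨ p = q⁻¹) ∧
      ∃ α αs a a' b b' c : F, c ≠ 0 ∧
        (∀ i : ℕ, i ≤ d → θ i = α + a * p ^ (2 * (i : ℤ) - (d : ℤ)) + a' * p ^ ((d : ℤ) - 2 * (i : ℤ))) ∧
        (∀ i : ℕ, i ≤ d → x i = αs + (b + b') * p ^ ((d : ℤ) - 2 * (i : ℤ)) + a' * c * p ^ ((d : ℤ) - 2 * (i : ℤ)) * (p ^ ((d : ℤ) + 1) + p ^ (-(d : ℤ) - 1) - p ^ ((d : ℤ) - 2 * (i : ℤ) - 1) - p ^ ((d : ℤ) - 2 * (i : ℤ) + 1))) ∧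
        (∀ i : ℕ, 1 ≤ i → i ≤ d → y i = (p ^ (i : ℤ) - p ^ (-(i : ℤ))) * (p ^ ((d : ℤ) - (i : ℤ) + 1) - p ^ ((i : ℤ) - (d : ℤ) - 1)) * (b - a' * c * p ^ ((d : ℤ) - 2 * (i : ℤ) + 1)) * (b' - a' * c * p ^ ((d : ℤ) - 2 * (i : ℤ) + 1)) * c⁻¹) ∧
        (∀ i : ℕ, 1 ≤ i → i ≤ d → z i = -(c * p ^ ((d : ℤ) - 2 * (i : ℤ) + 1))) ∧
        ((∀ j : ℕ, 1 ≤ j → j ≤ 2 * d - 1 → a ≠ a' * p ^ (2 * (d : ℤ) - 2 * (j : ℤ))) ∧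
     (∀ j : ℕ, 1 ≤ j → j ≤ 2 * d - 1 → b ≠ b' * p ^ (2 * (d : ℤ) - 2 * (j : ℤ))) ∧
     (∀ j : ℕ, 1 ≤ j → j ≤ d →
       b * c⁻¹ ≠ a * p ^ ((d : ℤ) - 2 * (j : ℤ) + 1) ∧
       b * c⁻¹ ≠ a' * p ^ ((d : ℤ) - 2 * (j : ℤ) + 1) ∧
       b' * c⁻¹ ≠ a * p ^ ((d : ℤ) - 2 * (j : ℤ) + 1) ∧
       b' * c⁻¹ ≠ a' * p ^ ((d : ℤ) - 2 * (j : ℤ) + 1))) := by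
  have hB : HasBands A (extendZero d fun _ => 1) (fun m => θ m.toNat) 0 := by
    have h : HasBands A (extendZero d fun _ => 1) (fun m => θ m.toNat)
        (extendZero d fun _ => 0) := hasBands_of_apply (by simpa using hA)
    rwa [show extendZero d (fun _ => (0 : F)) = 0 from funext fun _ => ite_self 0] at h
  have hBs := hasBands_of_apply hAs
  have hs : ∀ i : ℤ, 1 ≤ i → i ≤ d → extendZero d (fun _ => (1 : F)) i = 1 :=
    fun i h₁ h₂ => if_pos ⟨h₁, h₂⟩
  have hyz' : ∀ i : ℤ, 1 ≤ i → i ≤ d → extendZero d y i * extendZero d z i ≠ 0 := by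
    intro i h₁ h₂
    lift i to ℕ using by omega
    rw [extendZero_natCast y (by omega) (by omega), extendZero_natCast z (by omega) (by omega)]
    exact hyz i (by omega) (by omega)
  obtain ⟨γ, hγ⟩ := exists_recurrence (d := d) (β := q ^ 2 + (q ^ 2)⁻¹) (t := θ) fun i hi => by
    have := hqp (i + 2) (by omega) (by omega)
    rw [zpow_neg] at this
    exact_mod_cast this
  obtain ⟨t, γs, c₁, c₀, e₁, e₀, ρ, ht, htr, hγs, h₁, h₂⟩ :=
    hB.exists_relations (by omega) hBs hs hyz' hLP (β := q ^ 2 + (q ^ 2)⁻¹) (γ := γ) hγ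
  obtain ⟨p, hpq, W, hW, α, αs, a, a', b, b', c, E, hc, hE, hθ, ht', hx, hy, hz⟩ :=
    hB.exists_parameters hd hBs hs hyz' hq hqru hγ hγs htr h₁ h₂
  obtain ⟨hinj, U, V, hu, hirr⟩ := hB.exists_ordered_diagonalizedBy hBs hs
    (fun i h₁ h₂ => left_ne_zero_of_mul (hyz' i h₁ h₂)) hLP
  have hp : p ≠ 0 := by
    rcases hpq with rfl | rfl
    exacts [hq, inv_ne_zero hq]
  have hp4 : p ^ 4 ≠ 1 := by
    rcases hpq with rfl | rfl
    · exact hqru 4 (by norm_num)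
    · rw [inv_pow, Ne, inv_eq_one]
      exact hqru 4 (by norm_num)
  simp only [Int.toNat_natCast] at hθ hx
  have hpW : ∀ i, p * W i = p ^ ((d : ℤ) - 2 * i + 1) := fun i => by
    rw [hW, ← zpow_one_add₀ hp, add_comm]
  have hE' : E = p ^ ((d : ℤ) + 1) + p ^ (-(d : ℤ) - 1) := by
    rw [hE, hpW, ← zpow_neg]
    congr 2
    ring
  have hroot : ∀ {b b' : F} {j : ℕ}, 1 ≤ j → j ≤ d →
      (∀ i : ℕ, i ≤ d → x i = αs + (b + b') * W i + a' * c * W i * (E - W i * p⁻¹ - W i * p)) →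
      (∀ i : ℕ, i ≤ d + 1 → extendZero d y i = (E - (p * W i)⁻¹ - p * W i) *
          (b - a' * c * (p * W i)) * (b' - a' * c * (p * W i)) * c⁻¹) →
      b * c⁻¹ ≠ a * p ^ ((d : ℤ) - 2 * (j : ℤ) + 1) ∧
      b * c⁻¹ ≠ a' * p ^ ((d : ℤ) - 2 * (j : ℤ) + 1) := by
    intro b b' j hj₁ hj₂ hx hy
    constructor
    · intro h
      refine hirr.2 ⟨d - j + 1, by omega⟩ ⟨d - j, by omega⟩ (Or.inl rfl)
        (hB.conj_sub_apply_eq_zero hBs hs hu hp hp4 (W := W) (α := α) (αs := αs) (a := a)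
          (a' := a') (b := b) (b' := b') (fun i => ?_) (fun i => ?_) ?_ hc hE (fun i h₁ h₂ => ?_)
          (fun i h₁ h₂ => ?_) (fun i h₁ h₂ => ?_) (fun i h₁ h₂ => ?_) rfl ?_)
      · rw [hW, hW, ← zpow_natCast, ← zpow_add₀ hp]
        congr 1
        push_cast
        ring
      · rw [hW]
        exact zpow_ne_zero _ hp
      · rw [hpW, hpW, ← zpow_add₀ hp]
        convert zpow_zero p using 2
        ring
      · lift i to ℕ using h₁
        exact hθ i (by omega)
      · lift i to ℕ using h₁
        exact hx i (by omega)
      · lift i to ℕ using h₁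
        exact hy i (by omega)
      · lift i to ℕ using by omega
        exact hz i (by omega) (by omega)
      · have e : (d : ℤ) - 2 * j + 1 + (d - 2 * ((d - j : ℕ) + 1) + 1) = 0 := by
          rw [Nat.cast_sub hj₂]
          ring
        rw [(mul_inv_eq_iff_eq_mul₀ hc).1 h, mul_assoc _ p, hpW, mul_right_comm, mul_assoc a,
          ← zpow_add₀ hp, e, zpow_zero, mul_one]
    · intro h
      refine left_ne_zero_of_mul (hyz j hj₁ hj₂) ?_
      rw [← extendZero_natCast y hj₁ hj₂, hy j (by omega), (mul_inv_eq_iff_eq_mul₀ hc).1 h, hpW]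
      ring
  refine ⟨p, hpq, α, αs, a, a', b, b', c, hc, fun i hi => ?_, fun i hi => ?_, fun i hi₁ hi₂ => ?_,
    fun i hi₁ hi₂ => ?_, fun j => ne_mul_zpow_of_injective hp hW hθ fun i k hi hk e => ?_,
    fun j => ne_mul_zpow_of_injective hp hW ht' ht, fun j hj₁ hj₂ => ?_⟩
  · rw [hθ i hi, hW, ← zpow_neg, neg_sub]
  · rw [hx i hi, hE', mul_comm (W i) p, hpW, hW, ← zpow_sub_one₀ hp]
  · rw [← extendZero_natCast y hi₁ hi₂, hy i (by omega), hpW, hE', ← zpow_neg]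
    congr 3
    rw [sub_mul, mul_sub, mul_sub, ← zpow_add₀ hp, ← zpow_add₀ hp, ← zpow_add₀ hp, ← zpow_add₀ hp]
    ring_nf
  · rw [← extendZero_natCast z hi₁ hi₂, hz i hi₁ hi₂, hpW]
  · exact congrArg Fin.val (@hinj ⟨i, by omega⟩ ⟨k, by omega⟩ e)
  · obtain ⟨h₁, h₂⟩ := hroot hj₁ hj₂ hx hy
    obtain ⟨h₃, h₄⟩ := hroot (b := b') (b' := b) hj₁ hj₂ (fun i hi => by rw [hx i hi, add_comm b])
      (fun i hi => by rw [hy i hi]; ring)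
    exact ⟨h₁, h₂, h₃, h₄⟩
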